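/- arXiv:2311.09968 — 2 statements merged into one kernel-verified Lean document; each statement's English description precedes it below -/
import Mathlib

section
/- Let f : ℝⁿ → ℝ be smooth and let p be a nondegenerate critical point of f whose Hessian has index λ (the maximal dimension of a subspace on which the Hessian quadratic form is negative definite). Then there exist open neighborhoods U of 0 and V of p in ℝⁿ and a diffeomorphism φ : U → V with φ(0) = p such that for all y = (y₁,…,yₙ) ∈ U, f(φ(y)) = f(p) − (y₁² + ⋯ + y_λ²) + (y_{λ+1}² + ⋯ + yₙ²). -/
open scoped RealInnerProductSpace

open scoped ContDiff Topology
open Set Filter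


theorem hasFDerivAt_param {E G : Type} [NormedAddCommGroup E] [NormedSpace ℝ E] [ProperSpace E]
    [NormedAddCommGroup G] [NormedSpace ℝ G] {F : E × ℝ → G}
    (hF : ContDiff ℝ ∞ F) (x : E) :
    HasFDerivAt (fun x => ∫ t in (0:ℝ)..1, F (x, t))
      (∫ t in (0:ℝ)..1, (fderiv ℝ F (x, t)).comp (ContinuousLinearMap.inl ℝ E ℝ)) x := by
  have hc : Continuous (fun q : E × ℝ => (fderiv ℝ F q).comp (ContinuousLinearMap.inl ℝ E ℝ)) :=
    (hF.continuous_fderiv (by simp)).clm_comp continuous_const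
  obtain ⟨C, hC⟩ := ((isCompact_closedBall x 1).prod (isCompact_Icc (a := (0:ℝ)) (b := 1))).exists_bound_of_continuousOn
    hc.continuousOn
  refine intervalIntegral.hasFDerivAt_integral_of_dominated_of_fderiv_le (𝕜 := ℝ)
    (F := fun x t => F (x, t)) (bound := fun _ => C)
    (F' := fun x t => (fderiv ℝ F (x, t)).comp (ContinuousLinearMap.inl ℝ E ℝ))
    (Metric.closedBall_mem_nhds x one_pos) ?_ ?_ ?_ ?_ ?_ ?_
  · exact Eventually.of_forall fun y => (hF.continuous.comp (by fun_prop : Continuous fun t : ℝ => (y, t))).aestronglyMeasurable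
  · exact (hF.continuous.comp (by fun_prop : Continuous fun t : ℝ => (x, t))).intervalIntegrable _ _
  · exact (hc.comp (by fun_prop : Continuous fun t : ℝ => (x, t))).aestronglyMeasurable
  · refine Eventually.of_forall fun t ht y hy => hC (y, t) ⟨hy, ?_⟩
    rw [uIoc_of_le zero_le_one] at ht
    exact ⟨ht.1.le, ht.2⟩
  · exact intervalIntegrable_const
  · refine Eventually.of_forall fun t ht y hy => ?_
    have h1 : HasFDerivAt F (fderiv ℝ F (y, t)) (y, t) :=
      (hF.differentiable (by simp) _).hasFDerivAt
    exact h1.comp y (hasFDerivAt_prodMk_left y t)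

theorem contDiff_param_nat {E : Type} [NormedAddCommGroup E] [NormedSpace ℝ E] [ProperSpace E] (n : ℕ) :
    ∀ {G : Type} [NormedAddCommGroup G] [NormedSpace ℝ G] {F : E × ℝ → G},
    ContDiff ℝ ∞ F → ContDiff ℝ n (fun x => ∫ t in (0:ℝ)..1, F (x, t)) := by
  induction n with
  | zero =>
    intro G _ _ F hF
    refine contDiff_zero.2 ?_
    exact intervalIntegral.continuous_parametric_intervalIntegral_of_continuous' 
      (f := fun x t => F (x, t)) (by simpa [Function.uncurry_def] using hF.continuous) 0 1
  | succ n ih =>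
    intro G _ _ F hF
    rw [Nat.cast_add, Nat.cast_one, contDiff_succ_iff_fderiv]
    refine ⟨fun x => (hasFDerivAt_param hF x).differentiableAt, by simp, ?_⟩
    have : fderiv ℝ (fun x => ∫ t in (0:ℝ)..1, F (x, t)) = 
      fun x => ∫ t in (0:ℝ)..1, (fderiv ℝ F (x, t)).comp (ContinuousLinearMap.inl ℝ E ℝ) :=
      funext fun x => (hasFDerivAt_param hF x).fderiv
    rw [this]
    exact ih (F := fun q => (fderiv ℝ F q).comp (ContinuousLinearMap.inl ℝ E ℝ))
      ((hF.fderiv_right (by simp)).clm_comp contDiff_const)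

theorem contDiff_param {E G : Type} [NormedAddCommGroup E] [NormedSpace ℝ E] [ProperSpace E]
    [NormedAddCommGroup G] [NormedSpace ℝ G] {F : E × ℝ → G}
    (hF : ContDiff ℝ ∞ F) : ContDiff ℝ ∞ (fun x => ∫ t in (0:ℝ)..1, F (x, t)) :=
  contDiff_infty.2 fun n => contDiff_param_nat n hF

/-- Smooth square roots. -/
theorem exists_sqrt {X A : Type} [NormedAddCommGroup X] [NormedSpace ℝ X]
    [NormedRing A] [NormedAlgebra ℝ A] [CompleteSpace A] [StarRing A] [ContinuousStar A]
    {B : X → A} (hB : ContDiff ℝ ∞ B) (hs : ∀ x, star (B x) = B x) (x₀ : X) (a : Aˣ)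
    (ha : B x₀ = a) :
    ∃ R : X → A, (∀ᶠ x in 𝓝 x₀, ContDiffAt ℝ ∞ R x) ∧ R x₀ = 1 ∧
      ∀ᶠ x in 𝓝 x₀, star (R x) * a * R x = B x := by
  let sq : A → A := fun c => c * c
  have hsq : ContDiffAt ℝ ω sq 1 := (contDiff_id.mul contDiff_id).contDiffAt
  let D : A ≃L[ℝ] A := ContinuousLinearEquiv.smulLeft (Units.mk0 (2:ℝ) two_ne_zero)
  have hD : HasFDerivAt sq (D : A →L[ℝ] A) 1 := by
    have h := (hasFDerivAt_id (𝕜 := ℝ) (1 : A)).mul' (hasFDerivAt_id (𝕜 := ℝ) (1 : A))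
    refine h.congr_fderiv ?_
    ext c
    simp [D, two_smul, Units.smul_def]
  have hn : (ω : WithTop ℕ∞) ≠ 0 := by simp
  let S : A → A := hsq.localInverse hD hn
  have hS1 : S 1 = 1 := by
    have := hsq.localInverse_apply_image hD hn
    simpa [sq] using this
  have hSc : ContDiffAt ℝ ω S 1 := by
    have := hsq.to_localInverse hD hn
    simpa [sq] using this
  have hst := hsq.hasStrictFDerivAt' hD hn
  have hleft : ∀ᶠ c in 𝓝 (1:A), S (c * c) = c := hst.eventually_left_inverse
  have hright : ∀ᶠ c in 𝓝 (1:A), S c * S c = c := by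
    have := hst.eventually_right_inverse
    have h1 : sq 1 = 1 := by simp [sq]
    rw [h1] at this
    exact this
  let M : X → A := fun x => (↑a⁻¹ : A) * B x
  have hM : ContDiff ℝ ∞ M := contDiff_const.mul hB
  have hM0 : M x₀ = 1 := by simp [M, ha]
  have hMt : Tendsto M (𝓝 x₀) (𝓝 1) := by
    have := hM.continuous.tendsto x₀; rwa [hM0] at this
  have hasa : star (a : A) = a := by rw [← ha, hs]
  have hRt : Tendsto (fun x => S (M x)) (𝓝 x₀) (𝓝 1) := by
    have : Tendsto S (𝓝 1) (𝓝 1) := by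
      have := hSc.continuousAt.tendsto
      rwa [hS1] at this
    exact this.comp hMt
  have hσt : Tendsto (fun x => (↑a⁻¹ : A) * star (S (M x)) * a) (𝓝 x₀) (𝓝 1) := by
    have h1 : Continuous (fun c : A => (↑a⁻¹ : A) * star c * a) := by fun_prop
    have h2 := (h1.tendsto 1).comp hRt
    have h3 : (↑a⁻¹ : A) * star (1 : A) * a = 1 := by simp
    rw [h3] at h2
    exact h2
  refine ⟨fun x => S (M x), ?_, ?_, ?_⟩
  · have := hMt.eventually (hSc.eventually (by simp))
    filter_upwards [this] with x hx
    exact (hx.of_le (by simp)).comp x hM.contDiffAt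
  · simp [hM0, hS1]
  · filter_upwards [hMt.eventually hright, hσt.eventually hleft] with x h1 h2
    have h3 : (↑a⁻¹ : A) * star (S (M x)) * a * ((↑a⁻¹ : A) * star (S (M x)) * a) = M x := by
      calc _ = (↑a⁻¹ : A) * (star (S (M x)) * star (S (M x))) * a := by
            simp [mul_assoc]
        _ = (↑a⁻¹ : A) * star (M x) * a := by rw [← star_mul, h1]
        _ = M x := by
          have : star (M x) * a = B x := by
            have h : star (M x) * star (a : A) = star ((a : A) * M x) := (star_mul _ _).symm
            rw [hasa] at h
            rw [h]; simp [M, hs]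
          rw [mul_assoc, this]
    rw [h3] at h2
    have h4 : star (S (M x)) * a = a * S (M x) := by
      conv_rhs => rw [h2]
      simp [mul_assoc]
    rw [h4, mul_assoc, h1]
    simp [M]

theorem sylvester (n lam : ℕ) (A : EuclideanSpace ℝ (Fin n) →L[ℝ] EuclideanSpace ℝ (Fin n))
    (hA : ∀ v w, ⟪A v, w⟫ = ⟪A w, v⟫) (hinj : Function.Injective A)
    (h1 : ∃ W : Submodule ℝ (EuclideanSpace ℝ (Fin n)),
        Module.finrank ℝ W = lam ∧ ∀ v ∈ W, v ≠ 0 → ⟪A v, v⟫ < 0)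
    (h2 : ∀ W : Submodule ℝ (EuclideanSpace ℝ (Fin n)),
        (∀ v ∈ W, v ≠ 0 → ⟪A v, v⟫ < 0) → Module.finrank ℝ W ≤ lam) :
    ∃ T : EuclideanSpace ℝ (Fin n) ≃L[ℝ] EuclideanSpace ℝ (Fin n),
      ∀ v, ⟪A v, v⟫ = ∑ i : Fin n, (if (i : ℕ) < lam then -(T v i) ^ 2 else (T v i) ^ 2) := by
  let b : LinearMap.BilinForm ℝ (EuclideanSpace ℝ (Fin n)) :=
    (innerₗ (EuclideanSpace ℝ (Fin n))).comp (A : EuclideanSpace ℝ (Fin n) →ₗ[ℝ] EuclideanSpace ℝ (Fin n))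
  have hb : ∀ v w, b v w = ⟪A v, w⟫ := fun v w => rfl
  let Q : QuadraticForm ℝ (EuclideanSpace ℝ (Fin n)) := LinearMap.BilinMap.toQuadraticMap b
  have hQ : ∀ v, Q v = ⟪A v, v⟫ := fun v => rfl
  have hass : QuadraticMap.associated (R := ℝ) Q = b := QuadraticMap.associated_left_inverse ℝ (fun v w => hA v w)
  have hsep : (QuadraticMap.associated (R := ℝ) Q).SeparatingLeft := by
    rw [hass]
    intro v hv
    have : A v = 0 := by
      have := hv (A v); rw [hb] at this; exact inner_self_eq_zero.1 this
    exact hinj (by simpa using this)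
  have hw := Q.equivalent_one_neg_one_weighted_sum_squared hsep
  rw [finrank_euclideanSpace_fin] at hw
  obtain ⟨w, hw1, hw2⟩ := hw
  have hneg : ∀ W : Submodule ℝ (EuclideanSpace ℝ (Fin n)),
      ((-Q).restrict W).PosDef ↔ ∀ v ∈ W, v ≠ 0 → ⟪A v, v⟫ < 0 := by
    intro W
    simp only [QuadraticMap.PosDef]
    constructor
    · intro h v hv hv0
      have := h ⟨v, hv⟩ (by simpa using hv0)
      simp [QuadraticMap.restrict_apply, hQ] at this
      exact this
    · rintro h ⟨v, hv⟩ hv0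
      have := h v hv (by simpa using hv0)
      simp [QuadraticMap.restrict_apply, hQ]
      exact this
  have hsig : sigNeg Q = lam := by
    obtain ⟨W, hW, hW'⟩ := h1
    obtain ⟨W2, hW2, hW2'⟩ := exists_finrank_eq_sigNeg_and_negDef Q
    apply le_antisymm
    · rw [← hW2]; exact h2 W2 ((hneg _).1 hW2')
    · rw [← hW]; exact le_sigNeg_of_negDef Q ((hneg _).2 hW')
  have hcard : {i | w i < 0}.ncard = lam := by
    rw [← QuadraticForm.sigNeg_of_equiv_weightedSumSquares hw2, hsig]
  have hle : lam ≤ n := by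
    obtain ⟨W, hW, -⟩ := h1
    rw [← hW]; simpa using W.finrank_le
  classical
  have hc2 : Fintype.card {i : Fin n // (i : ℕ) < lam} = Fintype.card {i : Fin n // w i < 0} := by
    have e1 : Fintype.card {i : Fin n // w i < 0} = lam := by
      rw [← hcard, ← Nat.card_coe_set_eq, Nat.card_eq_fintype_card]; rfl
    rw [e1, Fintype.card_subtype, Fin.card_filter_val_lt]; simp [hle]
  let σ : Fin n ≃ Fin n := (Fintype.equivOfCardEq hc2).extendSubtype
  have hσ1 : ∀ i : Fin n, (i : ℕ) < lam → w (σ i) = -1 := by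
    intro i hi
    have := (Fintype.equivOfCardEq hc2).extendSubtype_mem i hi
    rcases hw1 (σ i) with h | h
    · exact h
    · change w (σ i) < 0 at this
      linarith
  have hσ2 : ∀ i : Fin n, ¬ (i : ℕ) < lam → w (σ i) = 1 := by
    intro i hi
    have := (Fintype.equivOfCardEq hc2).extendSubtype_not_mem i hi
    rcases hw1 (σ i) with h | h
    · change ¬ w (σ i) < 0 at this
      linarith
    · exact h
  obtain ⟨e⟩ := hw2
  let T : EuclideanSpace ℝ (Fin n) ≃ₗ[ℝ] EuclideanSpace ℝ (Fin n) :=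
    (e.toLinearEquiv.trans (LinearEquiv.funCongrLeft ℝ ℝ σ)).trans (WithLp.linearEquiv 2 ℝ (Fin n → ℝ)).symm
  have hT : ∀ v i, T v i = e v (σ i) := fun v i => rfl
  refine ⟨T.toContinuousLinearEquiv, fun v => ?_⟩
  have h3 := e.map_app v
  rw [← hQ, ← h3, QuadraticMap.weightedSumSquares_apply, ← Equiv.sum_comp σ]
  refine Finset.sum_congr rfl fun i _ => ?_
  have : T.toContinuousLinearEquiv v i = e v (σ i) := rfl
  rw [this]
  split_ifs with h
  · rw [hσ1 i h, smul_eq_mul]; ring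
  · rw [hσ2 i h, smul_eq_mul]; ring

theorem inner_gradient_apply {E : Type} [NormedAddCommGroup E] [InnerProductSpace ℝ E] [CompleteSpace E]
    (f : E → ℝ) (x v : E) : ⟪gradient f x, v⟫ = fderiv ℝ f x v := by
  simp [gradient]

theorem contDiff_gradient {E : Type} [NormedAddCommGroup E] [InnerProductSpace ℝ E] [CompleteSpace E]
    {f : E → ℝ} (hf : ContDiff ℝ ∞ f) : ContDiff ℝ ∞ (gradient f) := by
  have h : gradient f = fun x => (InnerProductSpace.toDual ℝ E).symm (fderiv ℝ f x) := rfl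
  rw [h]
  exact (InnerProductSpace.toDual ℝ E).symm.toContinuousLinearEquiv.contDiff.comp
    (hf.fderiv_right (by simp))

theorem hess_apply {E : Type} [NormedAddCommGroup E] [InnerProductSpace ℝ E] [CompleteSpace E]
    {f : E → ℝ} (hf : ContDiff ℝ ∞ f) (x v w : E) :
    ⟪fderiv ℝ (gradient f) x v, w⟫ = fderiv ℝ (fderiv ℝ f) x v w := by
  have hg : HasFDerivAt (gradient f) (fderiv ℝ (gradient f) x) x :=
    ((contDiff_gradient hf).differentiable (by simp) x).hasFDerivAt
  have h1 := (InnerProductSpace.toDual ℝ E).toContinuousLinearEquiv.hasFDerivAt.comp x hg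
  have h2 : (InnerProductSpace.toDual ℝ E).toContinuousLinearEquiv ∘ gradient f = fderiv ℝ f := by
    funext y
    simp [gradient]
  rw [h2] at h1
  rw [h1.fderiv]
  simp

theorem hess_symm {E : Type} [NormedAddCommGroup E] [InnerProductSpace ℝ E] [CompleteSpace E]
    {f : E → ℝ} (hf : ContDiff ℝ ∞ f) (x v w : E) :
    ⟪fderiv ℝ (gradient f) x v, w⟫ = ⟪fderiv ℝ (gradient f) x w, v⟫ := by
  rw [hess_apply hf, hess_apply hf]
  have h2 : ContDiff ℝ 2 f := contDiff_infty.1 hf 2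
  exact (h2.contDiffAt.isSymmSndFDerivAt (by simp)) v w

/-- Second-order Hadamard lemma at a critical point. -/
theorem exists_hadamard {E : Type} [NormedAddCommGroup E] [InnerProductSpace ℝ E]
    [FiniteDimensional ℝ E] {f : E → ℝ} (hf : ContDiff ℝ ∞ f) (p : E) (hp : gradient f p = 0) :
    ∃ B : E → (E →L[ℝ] E), ContDiff ℝ ∞ B ∧ (∀ x, star (B x) = B x) ∧
      B 0 = (1 / 2 : ℝ) • fderiv ℝ (gradient f) p ∧
      ∀ x, f (p + x) = f p + ⟪B x x, x⟫ := by
  let H : E → E →L[ℝ] E := fderiv ℝ (gradient f)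
  have hG := contDiff_gradient hf
  have hH : ContDiff ℝ ∞ H := hG.fderiv_right (by simp)
  let F : E × ℝ → E →L[ℝ] E := fun q => (1 - q.2) • H (p + q.2 • q.1)
  have hF : ContDiff ℝ ∞ F := by
    have h1 : ContDiff ℝ ∞ (fun q : E × ℝ => p + q.2 • q.1) := by fun_prop
    have h2 : ContDiff ℝ ∞ (fun q : E × ℝ => 1 - q.2) := by fun_prop
    exact h2.smul (hH.comp h1)
  have hFi : ∀ x, IntervalIntegrable (fun t => F (x, t)) MeasureTheory.volume 0 1 := fun x =>
    (hF.continuous.comp (by fun_prop : Continuous fun t : ℝ => (x, t))).intervalIntegrable _ _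
  have hin : ∀ x v w, ⟪(∫ t in (0:ℝ)..1, F (x, t)) v, w⟫ = ∫ t in (0:ℝ)..1, ⟪F (x, t) v, w⟫ := by
    intro x v w
    let L : (E →L[ℝ] E) →L[ℝ] ℝ := (innerSL ℝ w).comp (ContinuousLinearMap.apply ℝ E v)
    have h := L.intervalIntegral_comp_comm (hFi x)
    have hL : ∀ c, L c = ⟪c v, w⟫ := fun c => by simp [L, real_inner_comm]
    simp only [hL] at h
    exact h.symm
  have hFs : ∀ q v w, ⟪F q v, w⟫ = ⟪F q w, v⟫ := by
    intro q v w
    simp only [F, ContinuousLinearMap.smul_apply, inner_smul_left, H]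
    rw [hess_symm hf]
  refine ⟨fun x => ∫ t in (0:ℝ)..1, F (x, t), contDiff_param hF, ?_, ?_, ?_⟩
  · intro x
    rw [ContinuousLinearMap.star_eq_adjoint]
    symm
    rw [ContinuousLinearMap.eq_adjoint_iff]
    intro v w
    rw [hin, real_inner_comm, hin]
    simp only [hFs _ v w]
  · simp only [F, smul_zero, add_zero]
    rw [intervalIntegral.integral_smul_const]
    congr 1
    rw [intervalIntegral.integral_sub (by simp) (by simp)]
    norm_num
  · intro x
    rw [hin]
    have hd : ∀ t ∈ Set.uIcc (0:ℝ) 1, HasDerivAt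
        (fun t : ℝ => (1 - t) * ⟪gradient f (p + t • x), x⟫ + f (p + t • x))
        ⟪F (x, t) x, x⟫ t := by
      intro t _
      have hl : HasDerivAt (fun t : ℝ => p + t • x) x t := by
        simpa using ((hasDerivAt_id t).smul_const x).const_add p
      have h1 : HasDerivAt (fun t : ℝ => gradient f (p + t • x)) (H (p + t • x) x) t :=
        HasFDerivAt.comp_hasDerivAt (l := gradient f) t
          ((hG.differentiable (by simp) (p + t • x)).hasFDerivAt) hl
      have h2 : HasDerivAt (fun t : ℝ => f (p + t • x)) (fderiv ℝ f (p + t • x) x) t :=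
        ((hf.differentiable (by simp) (p + t • x)).hasFDerivAt).comp_hasDerivAt t hl
      have h3 : HasDerivAt (fun t : ℝ => ⟪gradient f (p + t • x), x⟫) ⟪H (p + t • x) x, x⟫ t := by
        simpa using h1.inner ℝ (hasDerivAt_const t x)
      have h4 : HasDerivAt (fun t : ℝ => 1 - t) (-1) t := by
        simpa using (hasDerivAt_id t).const_sub 1
      refine ((h4.mul h3).add h2).congr_deriv ?_
      rw [inner_gradient_apply]
      simp only [F, ContinuousLinearMap.smul_apply, inner_smul_left]
      simp
    have hc : IntervalIntegrable (fun t => ⟪F (x, t) x, x⟫) MeasureTheory.volume 0 1 := by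
      have h1 : Continuous fun t : ℝ => F (x, t) :=
        hF.continuous.comp (by fun_prop : Continuous fun t : ℝ => (x, t))
      exact ((h1.clm_apply continuous_const).inner continuous_const).intervalIntegrable _ _
    rw [intervalIntegral.integral_eq_sub_of_hasDerivAt hd hc]
    simp [hp]

/-- Local diffeomorphism from the inverse function theorem, in a form with explicit sets. -/
theorem exists_local_diffeo {E : Type} [NormedAddCommGroup E] [NormedSpace ℝ E] [CompleteSpace E]
    {Φ : E → E} {p : E} (T : E ≃L[ℝ] E) (hc : ∀ᶠ x in 𝓝 p, ContDiffAt ℝ ∞ Φ x)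
    (hT : HasFDerivAt Φ (T : E →L[ℝ] E) p) {P : E → Prop} (hP : ∀ᶠ x in 𝓝 p, P x) :
    ∃ (U V : Set E) (φ : E → E), IsOpen U ∧ IsOpen V ∧ Φ p ∈ U ∧ p ∈ V ∧
      ContDiffOn ℝ ∞ φ U ∧ ContDiffOn ℝ ∞ Φ V ∧ Set.MapsTo φ U V ∧ Set.MapsTo Φ V U ∧
      (∀ x ∈ U, Φ (φ x) = x) ∧ (∀ y ∈ V, φ (Φ y) = y) ∧ ∀ y ∈ V, P y := by
  have hp := hc.self_of_nhds
  let e := hp.toOpenPartialHomeomorph Φ hT (by simp)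
  have hinv : ∀ᶠ x in 𝓝 p, ∃ D : E ≃L[ℝ] E, (D : E →L[ℝ] E) = fderiv ℝ Φ x := by
    have h1 : ContinuousAt (fderiv ℝ Φ) p := hp.continuousAt_fderiv (by simp)
    have h2 := ContinuousLinearEquiv.nhds T
    rw [← hT.fderiv] at h2
    exact h1.eventually h2
  have hsrc : ∀ᶠ x in 𝓝 p, x ∈ e.source :=
    e.open_source.mem_nhds (hp.mem_toOpenPartialHomeomorph_source hT (by simp))
  obtain ⟨V, hV, hVo, hpV⟩ := eventually_nhds_iff.1 (hc.and (hinv.and (hsrc.and hP)))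
  have hVs : V ⊆ e.source := fun x hx => (hV x hx).2.2.1
  have heq : ∀ x, e x = Φ x := fun x => rfl
  refine ⟨e '' V, V, e.symm, e.isOpen_image_of_subset_source hVo hVs, hVo, ⟨p, hpV, rfl⟩, hpV, ?_, ?_,
    ?_, ?_, ?_, ?_, ?_⟩
  · rintro _ ⟨x, hx, rfl⟩
    obtain ⟨h1, ⟨D, hD⟩, h3, h4⟩ := hV x hx
    refine ContDiffAt.contDiffWithinAt ?_
    refine e.contDiffAt_symm (f₀' := D) (e.map_source h3) ?_ ?_
    · rw [e.left_inv h3, hD]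
      exact (h1.differentiableAt (by simp)).hasFDerivAt
    · rw [e.left_inv h3]; exact h1
  · intro x hx
    exact (hV x hx).1.contDiffWithinAt
  · rintro _ ⟨x, hx, rfl⟩
    rw [e.left_inv (hVs hx)]; exact hx
  · intro x hx; exact ⟨x, hx, rfl⟩
  · rintro _ ⟨x, hx, rfl⟩
    rw [e.left_inv (hVs hx)]; rfl
  · intro x hx; exact e.left_inv (hVs hx)
  · intro x hx; exact (hV x hx).2.2.2

/-- The Morse lemma. If `p` is a nondegenerate critical point of a smooth
function `f : ℝⁿ → ℝ` whose Hessian has index `lam`, then there is a diffeomorphism `φ`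
from a neighborhood `U` of `0` onto a neighborhood `V` of `p` with `φ 0 = p` such that
`f (φ y) = f p - (y₁² + ⋯ + y_lam²) + (y_{lam+1}² + ⋯ + yₙ²)` on `U`. -/
theorem morse_lemma
    (n lam : ℕ) (f : EuclideanSpace ℝ (Fin n) → ℝ)
    (hf : ContDiff ℝ (⊤ : ℕ∞) f)
    (p : EuclideanSpace ℝ (Fin n))
    (hcrit : gradient f p = 0)
    (hnd : Function.Injective (fderiv ℝ (gradient f) p))
    (hindex_le : ∃ W : Submodule ℝ (EuclideanSpace ℝ (Fin n)),
        Module.finrank ℝ W = lam ∧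
        ∀ v ∈ W, v ≠ 0 → ⟪fderiv ℝ (gradient f) p v, v⟫ < 0)
    (hindex_max : ∀ W : Submodule ℝ (EuclideanSpace ℝ (Fin n)),
        (∀ v ∈ W, v ≠ 0 → ⟪fderiv ℝ (gradient f) p v, v⟫ < 0) →
        Module.finrank ℝ W ≤ lam) :
    ∃ (U V : Set (EuclideanSpace ℝ (Fin n)))
      (φ ψ : EuclideanSpace ℝ (Fin n) → EuclideanSpace ℝ (Fin n)),
      IsOpen U ∧ IsOpen V ∧ (0 : EuclideanSpace ℝ (Fin n)) ∈ U ∧ p ∈ V ∧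
      ContDiffOn ℝ (⊤ : ℕ∞) φ U ∧ ContDiffOn ℝ (⊤ : ℕ∞) ψ V ∧
      Set.MapsTo φ U V ∧ Set.MapsTo ψ V U ∧
      (∀ x ∈ U, ψ (φ x) = x) ∧ (∀ y ∈ V, φ (ψ y) = y) ∧
      φ 0 = p ∧
      ∀ y ∈ U, f (φ y) = f p + ∑ i : Fin n,
        (if (i : ℕ) < lam then -(y i) ^ 2 else (y i) ^ 2) := by
  obtain ⟨B, hB, hBs, hB0, hBf⟩ := exists_hadamard hf p hcrit
  have hB0i : ∀ v w, ⟪B 0 v, w⟫ = (1 / 2) * ⟪fderiv ℝ (gradient f) p v, w⟫ := by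
    intro v w
    rw [hB0, ContinuousLinearMap.smul_apply, inner_smul_left]; simp
  have hneg : ∀ v, ⟪B 0 v, v⟫ < 0 ↔ ⟪fderiv ℝ (gradient f) p v, v⟫ < 0 := by
    intro v; rw [hB0i]; constructor <;> intro h <;> linarith
  have hinj : Function.Injective (B 0) := by
    intro v w h
    rw [hB0, ContinuousLinearMap.smul_apply, ContinuousLinearMap.smul_apply] at h
    exact hnd (smul_right_injective _ (by norm_num : (1 / 2 : ℝ) ≠ 0) h)
  obtain ⟨T, hT⟩ := sylvester n lam (B 0) (fun v w => by rw [hB0i, hB0i, hess_symm hf]) hinj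
    (by simpa only [hneg] using hindex_le) (by simpa only [hneg] using hindex_max)
  let D : EuclideanSpace ℝ (Fin n) ≃L[ℝ] EuclideanSpace ℝ (Fin n) :=
    (LinearEquiv.ofInjectiveEndo (B 0 : EuclideanSpace ℝ (Fin n) →ₗ[ℝ] EuclideanSpace ℝ (Fin n))
      hinj).toContinuousLinearEquiv
  let a : (EuclideanSpace ℝ (Fin n) →L[ℝ] EuclideanSpace ℝ (Fin n))ˣ :=
    ContinuousLinearEquiv.toUnit D
  have ha : B 0 = a := by ext1 v; rfl
  obtain ⟨R, hR, hR0, hRB⟩ := exists_sqrt hB hBs 0 a ha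
  let Φ : EuclideanSpace ℝ (Fin n) → EuclideanSpace ℝ (Fin n) := fun x => T (R (x - p) (x - p))
  have hsub : Tendsto (fun x => x - p) (𝓝 p) (𝓝 0) := by
    have : Continuous (fun x : EuclideanSpace ℝ (Fin n) => x - p) := by fun_prop
    have := this.tendsto p
    rwa [sub_self] at this
  have hΦ : ∀ᶠ x in 𝓝 p, ContDiffAt ℝ ∞ Φ x := by
    filter_upwards [hsub.eventually hR] with x hx
    have h1 : ContDiffAt ℝ ∞ (fun x => x - p) x := by fun_prop
    exact T.contDiff.contDiffAt.comp x ((hx.comp x h1).clm_apply h1)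
  have hΦ' : HasFDerivAt Φ (T : EuclideanSpace ℝ (Fin n) →L[ℝ] EuclideanSpace ℝ (Fin n)) p := by
    have h1 : HasFDerivAt (fun x => x - p)
      (ContinuousLinearMap.id ℝ (EuclideanSpace ℝ (Fin n))) p := (hasFDerivAt_id p).sub_const p
    have h2 : DifferentiableAt ℝ (fun x => R (x - p)) p := by
      have h3 : DifferentiableAt ℝ R (p - p) := by
        rw [sub_self]; exact hR.self_of_nhds.differentiableAt (by simp)
      exact DifferentiableAt.comp (f := fun x => x - p) p h3 h1.differentiableAt
    have h4 := T.hasFDerivAt.comp p (h2.hasFDerivAt.clm_apply h1)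
    refine h4.congr_fderiv ?_
    ext1 v
    simp [hR0]
  have hmain : ∀ᶠ x in 𝓝 p, f x = f p + ∑ i : Fin n,
        (if (i : ℕ) < lam then -(Φ x i) ^ 2 else (Φ x i) ^ 2) := by
    filter_upwards [hsub.eventually hRB] with x hx
    rw [← hT (R (x - p) (x - p))]
    have h := hBf (x - p)
    rw [add_sub_cancel] at h
    rw [h, ← hx, ha, ContinuousLinearMap.star_eq_adjoint]
    simp only [ContinuousLinearMap.mul_apply]
    rw [ContinuousLinearMap.adjoint_inner_left]
  have hΦp : Φ p = 0 := by simp [Φ]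
  obtain ⟨U, V, φ, h1, h2, h3, h4, h5, h6, h7, h8, h9, h10, h11⟩ :=
    exists_local_diffeo T hΦ hΦ' hmain
  rw [hΦp] at h3
  refine ⟨U, V, φ, Φ, h1, h2, h3, h4, h5, h6, h7, h8, h9, h10, ?_, ?_⟩
  · rw [← hΦp]; exact h10 p h4
  · intro y hy
    have := h11 (φ y) (h7 hy)
    rwa [h9 y hy] at this
end

section
/- Let n ≥ 1 and let f : ℝⁿ → ℝ be real analytic. For any critical point p of f, there exist a neighborhood U of p and constants C > 0 and θ ∈ [1/2, 1) such that ‖∇f(q)‖ ≥ C|f(q) − f(p)|^θ for all q ∈ U. -/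
open Filter Topology

@[fun_prop]
theorem LG.an_fst {E F G : Type*} [NormedAddCommGroup E] [NormedSpace ℝ E]
    [NormedAddCommGroup F] [NormedSpace ℝ F] [NormedAddCommGroup G] [NormedSpace ℝ G]
    {f : E → F × G} {x : E} (hf : AnalyticAt ℝ f x) : AnalyticAt ℝ (fun y => (f y).1) x :=
  AnalyticAt.fun_comp (g := Prod.fst) analyticAt_fst hf

@[fun_prop]
theorem LG.an_snd {E F G : Type*} [NormedAddCommGroup E] [NormedSpace ℝ E]
    [NormedAddCommGroup F] [NormedSpace ℝ F] [NormedAddCommGroup G] [NormedSpace ℝ G]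
    {f : E → F × G} {x : E} (hf : AnalyticAt ℝ f x) : AnalyticAt ℝ (fun y => (f y).2) x :=
  AnalyticAt.fun_comp (g := Prod.snd) analyticAt_snd hf

@[fun_prop]
theorem LG.an_apply {ι : Type*} [Fintype ι] (i : ι) (x : ι → ℝ) :
    AnalyticAt ℝ (fun y : ι → ℝ => y i) x :=
  analyticAt_pi_iff.1 analyticAt_id i

@[fun_prop]
theorem LG.an_pi {E ι : Type*} [NormedAddCommGroup E] [NormedSpace ℝ E] [Fintype ι]
    {f : E → ι → ℝ} {x : E} (hf : ∀ i, AnalyticAt ℝ (fun y => f y i) x) :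
    AnalyticAt ℝ (fun y i => f y i) x :=
  analyticAt_pi_iff.2 hf

@[fun_prop]
theorem LG.an_prod {E ι : Type*} [NormedAddCommGroup E] [NormedSpace ℝ E] (s : Finset ι)
    {f : ι → E → ℝ} {x : E} (hf : ∀ i, AnalyticAt ℝ (f i) x) :
    AnalyticAt ℝ (fun y => ∏ i ∈ s, f i y) x :=
  Finset.analyticAt_fun_prod s fun i _ => hf i

@[fun_prop]
theorem LG.an_sum {E ι : Type*} [NormedAddCommGroup E] [NormedSpace ℝ E] (s : Finset ι)
    {f : ι → E → ℝ} {x : E} (hf : ∀ i, AnalyticAt ℝ (f i) x) :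
    AnalyticAt ℝ (fun y => ∑ i ∈ s, f i y) x :=
  Finset.analyticAt_fun_sum s fun i _ => hf i


theorem LG.division {E : Type*} [NormedAddCommGroup E] [NormedSpace ℝ E]
    (l : E →L[ℝ] ℝ) (e : E) (P : E →L[ℝ] E) (hP : ∀ x, P x = x - l x • e)
    (F : E → ℝ) (hF : AnalyticAt ℝ F 0) :
    ∃ G : E → ℝ, AnalyticAt ℝ G 0 ∧ ∀ᶠ x in 𝓝 (0 : E), F x = F (P x) + l x * G x := by
  obtain ⟨p, hp⟩ := hF
  let A : (k : ℕ) → Fin (k+1) → Fin k → (E →L[ℝ] E) := fun k j i =>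
    if (j.succAbove i).val < j.val then ContinuousLinearMap.id ℝ E else P
  let q : FormalMultilinearSeries ℝ E ℝ := fun k =>
    ∑ j : Fin (k+1), ((p (k+1)).curryMid j e).compContinuousLinearMap (A k j)
  set M : ℝ := 1 + ‖P‖ with hM
  have hM1 : 1 ≤ M := by have := norm_nonneg P; linarith
  have hA : ∀ k j i, ‖A k j i‖ ≤ M := by
    intro k j i
    simp only [A]
    split_ifs
    · exact ContinuousLinearMap.norm_id_le.trans hM1
    · linarith
  have hq : ∀ k, ‖q k‖ ≤ (k+1) * (‖p (k+1)‖ * ‖e‖ * M ^ k) := by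
    intro k
    calc ‖q k‖ ≤ ∑ j : Fin (k+1), ‖((p (k+1)).curryMid j e).compContinuousLinearMap (A k j)‖ :=
          norm_sum_le _ _
      _ ≤ ∑ j : Fin (k+1), (‖p (k+1)‖ * ‖e‖ * M ^ k) := by
          refine Finset.sum_le_sum fun j _ => ?_
          refine (ContinuousMultilinearMap.norm_compContinuousLinearMap_le _ _).trans ?_
          have h1 : ‖(p (k+1)).curryMid j e‖ ≤ ‖p (k+1)‖ * ‖e‖ := by
            refine (ContinuousLinearMap.le_opNorm _ _).trans ?_
            rw [ContinuousMultilinearMap.norm_curryMid]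
          have h2 : ∏ i, ‖A k j i‖ ≤ M ^ k := by
            refine (Finset.prod_le_prod (fun i _ => norm_nonneg _) (fun i _ => hA k j i)).trans ?_
            simp
          exact mul_le_mul h1 h2 (Finset.prod_nonneg fun i _ => norm_nonneg _) (by positivity)
      _ = _ := by simp
  obtain ⟨C, r, hC, hr, hpb⟩ := p.le_mul_pow_of_radius_pos hp.radius_pos
  have hrad : 0 < q.radius := by
    have hpos : 0 < 1 / (2 * M * r) := by positivity
    have h := q.le_radius_of_bound (C * r * ‖e‖) (r := ⟨1 / (2 * M * r), hpos.le⟩) (by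
      intro k
      have hk : ((k:ℝ)+1) ≤ 2 ^ k := by
        have : k + 1 ≤ 2 ^ k := Nat.lt_two_pow_self
        exact_mod_cast this
      calc ‖q k‖ * (1 / (2 * M * r)) ^ k
          ≤ (2^k * ((C * r ^ (k+1)) * ‖e‖ * M ^ k)) * (1 / (2 * M * r)) ^ k := by
            gcongr
            refine (hq k).trans ?_
            gcongr
            exact hpb _
        _ = C * r * ‖e‖ := by
            rw [div_pow, mul_pow, mul_pow, pow_succ]
            field_simp
            simp)
    refine lt_of_lt_of_le ?_ h
    exact ENNReal.coe_pos.2 (by exact hpos)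
  have hG := q.hasFPowerSeriesOnBall hrad
  refine ⟨q.sum, hG.analyticAt, ?_⟩
  have hPt : Tendsto P (𝓝 0) (𝓝 0) := by
    have := P.continuous.tendsto 0
    simpa using this
  have key : ∀ k (x : E), p (k+1) (fun _ => x) - p (k+1) (fun _ => P x) = l x * q k (fun _ => x) := by
    intro k x
    let T : ℕ → ℝ := fun j => p (k+1) (fun i => if i.val < j then x else P x)
    have h1 : p (k+1) (fun _ => x) - p (k+1) (fun _ => P x) = T (k+1) - T 0 := by
      have : (fun i : Fin (k+1) => if i.val < k+1 then x else P x) = fun _ => x := by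
        funext i; rw [if_pos i.isLt]
      simp only [T, this]
      simp
    rw [h1, ← Finset.sum_range_sub, Finset.sum_range, _root_.sum_apply,
      Finset.mul_sum]
    refine Finset.sum_congr rfl fun j _ => ?_
    let m : Fin (k+1) → E := fun i => if i.val < j.val then x else P x
    have e1 : T (j.val + 1) = p (k+1) (Function.update m j x) := by
      simp only [T]; congr 1; funext i
      by_cases hi : i = j
      · subst hi; simp
      · have : i.val ≠ j.val := fun h => hi (Fin.ext h)
        simp only [Function.update_of_ne hi, m]
        have : i.val < j.val + 1 ↔ i.val < j.val := by omega
        simp [this]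
    have e2 : T j.val = p (k+1) (Function.update m j (P x)) := by
      simp only [T]; congr 1; funext i
      by_cases hi : i = j
      · subst hi; simp
      · simp [Function.update_of_ne hi, m]
    have e3 : x - P x = l x • e := by rw [hP]; abel
    rw [e1, e2, ← ContinuousMultilinearMap.map_update_sub, e3,
      ContinuousMultilinearMap.map_update_smul, smul_eq_mul]
    congr 1
    rw [ContinuousMultilinearMap.compContinuousLinearMap_apply,
      ContinuousMultilinearMap.curryMid_apply]
    congr 1
    funext i
    by_cases hi : i = j
    · subst hi; simp
    · obtain ⟨i', rfl⟩ := Fin.exists_succAbove_eq hi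
      simp only [Function.update_of_ne hi, Fin.insertNth_apply_succAbove, m, A]
      split_ifs <;> simp
  have hs := hp.eventually_hasSum
  filter_upwards [hs, hPt.eventually hs, hG.eventually_hasSum] with x h1 h2 h3
  simp only [zero_add] at h1 h2 h3
  have h4 := (h1.sub h2)
  rw [← hasSum_nat_add_iff' 1] at h4
  have h5 := h3.mul_left (l x)
  have h6 : (fun n => p (n+1) (fun _ => x) - p (n+1) (fun _ => P x)) = fun n => l x * q n (fun _ => x) := by
    funext n; exact key n x
  rw [h6] at h4
  have h7 := h4.unique h5
  have h8 : p 0 (fun _ => x) = p 0 (fun _ => P x) := by congr 1; funext i; exact i.elim0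
  simp [h8] at h7
  linarith

theorem LG.domain {E : Type*} [NormedAddCommGroup E] [NormedSpace ℝ E]
    {f g : E → ℝ} (hf : AnalyticAt ℝ f 0) (hg : AnalyticAt ℝ g 0)
    (h : ∀ᶠ x in 𝓝 (0 : E), f x * g x = 0) :
    (∀ᶠ x in 𝓝 (0 : E), f x = 0) ∨ (∀ᶠ x in 𝓝 (0 : E), g x = 0) := by
  by_cases h0 : ∀ᶠ x in 𝓝 (0 : E), f x = 0
  · exact Or.inl h0
  right
  obtain ⟨r1, hr1, hf1⟩ := hf.exists_ball_analyticOnNhd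
  obtain ⟨r2, hr2, hg1⟩ := hg.exists_ball_analyticOnNhd
  obtain ⟨r3, hr3, h3⟩ := Metric.eventually_nhds_iff_ball.1 h
  set r := min r1 (min r2 r3) with hr
  have hrpos : 0 < r := by positivity
  have hb : Metric.ball (0 : E) r ∈ 𝓝 0 := Metric.ball_mem_nhds _ hrpos
  have : ∃ x ∈ Metric.ball (0 : E) r, f x ≠ 0 := by
    by_contra! hcon
    exact h0 (by filter_upwards [hb] with x hx using hcon x hx)
  obtain ⟨x, hx, hfx⟩ := this
  have hxr1 : x ∈ Metric.ball (0 : E) r1 := Metric.ball_subset_ball (min_le_left _ _) hx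
  have hcf : ∀ᶠ y in 𝓝 x, f y ≠ 0 := (hf1 x hxr1).continuousAt.eventually_ne hfx
  have hgx : g =ᶠ[𝓝 x] 0 := by
    filter_upwards [hcf, Metric.isOpen_ball.mem_nhds hx] with y hy1 hy2
    have := h3 y (Metric.ball_subset_ball ((min_le_right _ _).trans (min_le_right _ _)) hy2)
    exact (mul_eq_zero.1 this).resolve_left hy1
  have hgr : AnalyticOnNhd ℝ g (Metric.ball (0 : E) r) :=
    hg1.mono (Metric.ball_subset_ball ((min_le_right _ _).trans (min_le_left _ _)))
  have := hgr.eqOn_zero_of_preconnected_of_eventuallyEq_zero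
    (convex_ball (0 : E) r).isPreconnected hx hgx
  filter_upwards [hb] with y hy using this hy

theorem LG.coef_unique (d : ℕ) : ∀ (C : ℕ → ℝ) (W : ℝ → ℝ), ContinuousAt W 0 →
    (∀ᶠ z in 𝓝 (0 : ℝ), ∑ i ∈ Finset.range d, C i * z ^ i + z ^ d * W z = 0) →
    (∀ i < d, C i = 0) ∧ W 0 = 0 := by
  induction d with
  | zero =>
    intro C W hW h
    refine ⟨fun i hi => absurd hi (Nat.not_lt_zero i), ?_⟩
    have := h.self_of_nhds
    simpa using this
  | succ d ih =>
    intro C W hW h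
    have h0 : C 0 = 0 := by
      have := h.self_of_nhds
      simpa [Finset.sum_range_succ'] using this
    set S : ℝ → ℝ := fun z => ∑ i ∈ Finset.range d, C (i+1) * z ^ i + z ^ d * W z with hS
    have hSc : ContinuousAt S 0 := by
      have : ContinuousAt (fun z : ℝ => ∑ i ∈ Finset.range d, C (i+1) * z ^ i) 0 := by fun_prop
      exact this.add ((continuousAt_id.pow d).mul hW)
    have h1 : ∀ᶠ z in 𝓝 (0 : ℝ), z * S z = 0 := by
      filter_upwards [h] with z hz
      rw [Finset.sum_range_succ', h0] at hz
      rw [← hz, hS]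
      simp only [mul_add, Finset.mul_sum, pow_succ]
      congr 1
      · simp only [pow_zero, zero_mul, add_zero]
        refine Finset.sum_congr rfl fun i _ => by ring
      · ring
    have h2 : ∀ᶠ z in 𝓝[≠] (0 : ℝ), S z = 0 := by
      have := h1.filter_mono (nhdsWithin_le_nhds (s := {0}ᶜ))
      filter_upwards [this, self_mem_nhdsWithin] with z hz hz0
      exact (mul_eq_zero.1 hz).resolve_left hz0
    have h3 : S 0 = 0 := by
      have t1 : Tendsto S (𝓝[≠] 0) (𝓝 (S 0)) := hSc.tendsto.mono_left nhdsWithin_le_nhds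
      have t2 : Tendsto S (𝓝[≠] 0) (𝓝 0) := by
        refine Tendsto.congr' ?_ tendsto_const_nhds
        filter_upwards [h2] with z hz using hz.symm
      exact tendsto_nhds_unique t1 t2
    have h4 : ∀ᶠ z in 𝓝 (0 : ℝ), S z = 0 := by
      filter_upwards [h1] with z hz
      by_cases hz0 : z = 0
      · rw [hz0, h3]
      · exact (mul_eq_zero.1 hz).resolve_left hz0
    obtain ⟨a, b⟩ := ih (fun i => C (i+1)) W hW h4
    refine ⟨fun i hi => ?_, b⟩
    cases i with
    | zero => exact h0
    | succ i => exact a i (by omega)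

theorem LG.taylor {E : Type*} [NormedAddCommGroup E] [NormedSpace ℝ E]
    (F : E × ℝ → ℝ) (hF : AnalyticAt ℝ F 0) (d : ℕ) :
    ∃ C : ℕ → E → ℝ, (∀ i, AnalyticAt ℝ (C i) 0) ∧ ∃ U : E × ℝ → ℝ, AnalyticAt ℝ U 0 ∧
      ∀ᶠ p in 𝓝 (0 : E × ℝ),
        F p = ∑ i ∈ Finset.range d, C i p.1 * p.2 ^ i + p.2 ^ d * U p := by
  induction d with
  | zero => exact ⟨fun _ _ => 0, fun _ => analyticAt_const, F, hF, by simp⟩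
  | succ d ih =>
    obtain ⟨C, hC, U, hU, h⟩ := ih
    obtain ⟨G, hG, hUG⟩ := LG.division (ContinuousLinearMap.snd ℝ E ℝ) ((0 : E), (1 : ℝ))
      ((ContinuousLinearMap.inl ℝ E ℝ).comp (ContinuousLinearMap.fst ℝ E ℝ))
      (by rintro ⟨x, z⟩; simp) U hU
    have hc : AnalyticAt ℝ (fun x : E => U (x, 0)) 0 := by
      have h2 : AnalyticAt ℝ (fun x : E => (x, (0:ℝ))) 0 := by fun_prop
      exact AnalyticAt.fun_comp (g := U) (f := fun x : E => (x, (0:ℝ))) hU h2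
    refine ⟨fun i => if i = d then fun x => U (x, 0) else C i, ?_, G, hG, ?_⟩
    · intro i
      by_cases hi : i = d
      · simpa [hi] using hc
      · simpa [hi] using hC i
    · filter_upwards [h, hUG] with p h1 h2
      rw [h1, Finset.sum_range_succ, h2]
      have : ∑ i ∈ Finset.range d, (if i = d then fun x => U (x, 0) else C i) p.1 * p.2 ^ i
          = ∑ i ∈ Finset.range d, C i p.1 * p.2 ^ i := by
        refine Finset.sum_congr rfl fun i hi => ?_
        have : i ≠ d := by have := Finset.mem_range.1 hi; omega
        simp [this]
      rw [this]
      simp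
      ring

theorem LG.ift {V : Type*} [NormedAddCommGroup V] [NormedSpace ℝ V] [CompleteSpace V]
    (C : V × ℝ → ℝ) (hC : AnalyticAt ℝ C 0) (h0 : C 0 = 0)
    (hd : fderiv ℝ C 0 (0, 1) ≠ 0) :
    ∃ h : V → ℝ, AnalyticAt ℝ h 0 ∧ h 0 = 0 ∧ ∀ᶠ x in 𝓝 (0 : V), C (x, h x) = 0 := by
  have cd : ContDiffAt ℝ ⊤ C 0 := hC.contDiffAt
  have inv : (fderiv ℝ C 0 ∘L .inr ℝ V ℝ).IsInvertible := by
    refine ⟨ContinuousLinearEquiv.unitsEquivAut ℝ (Units.mk0 _ hd), ?_⟩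
    ext
    simp
  refine ⟨cd.implicitFunction (by simp) inv, ?_, cd.implicitFunction_apply_self (by simp) inv, ?_⟩
  · exact (cd.contDiffAt_implicitFunction (by simp) inv).analyticAt
  · have := cd.eventually_apply_implicitFunction (by simp) inv
    rw [h0] at this
    exact this

theorem LG.tsch {V : Type*} [NormedAddCommGroup V] [NormedSpace ℝ V] [CompleteSpace V]
    (g : V × ℝ → ℝ) (hg : AnalyticAt ℝ g 0) (m : ℕ) (u1 : ℝ → ℝ) (hu1 : ContinuousAt u1 0)
    (hu10 : u1 0 ≠ 0) (hgd : ∀ᶠ z in 𝓝 (0 : ℝ), g (0, z) = z ^ (m+1) * u1 z) :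
    ∃ h : V → ℝ, AnalyticAt ℝ h 0 ∧ h 0 = 0 ∧ ∃ c : ℕ → V → ℝ, (∀ i, AnalyticAt ℝ (c i) 0) ∧
      (∀ i < m, c i 0 = 0) ∧ ∃ u : V × ℝ → ℝ, AnalyticAt ℝ u 0 ∧ u 0 ≠ 0 ∧
      ∀ᶠ p in 𝓝 (0 : V × ℝ), g (p.1, p.2 + h p.1) =
        ∑ i ∈ Finset.range m, c i p.1 * p.2 ^ i + p.2 ^ (m+1) * u p := by
  have hF : AnalyticAt ℝ (fun q : (V × ℝ) × ℝ => g (q.1.1, q.1.2 + q.2)) 0 := by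
    have h2 : AnalyticAt ℝ (fun q : (V × ℝ) × ℝ => (q.1.1, q.1.2 + q.2)) 0 := by fun_prop
    refine AnalyticAt.fun_comp (g := g) ?_ h2
    have : ((0:V), (0:ℝ)+0) = 0 := by rw [add_zero]; rfl
    change AnalyticAt ℝ g ((0:V), (0:ℝ)+0)
    rw [this]; exact hg
  obtain ⟨C, hC, U, hU, hT⟩ := LG.taylor _ hF (m+1)
  have hUz : AnalyticAt ℝ (fun z : ℝ => U ((0, 0), z)) 0 := by
    refine AnalyticAt.fun_comp (g := U) (f := fun z : ℝ => (((0:V), (0:ℝ)), z)) hU (by fun_prop)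
  have t0 : Tendsto (fun z : ℝ => (((0:V), (0:ℝ)), z)) (𝓝 0) (𝓝 0) := by
    have : ContinuousAt (fun z : ℝ => (((0:V), (0:ℝ)), z)) 0 := by fun_prop
    exact this.tendsto
  have e0 : ∀ᶠ z in 𝓝 (0:ℝ), ∑ i ∈ Finset.range (m+1), C i (0,0) * z ^ i +
      z ^ (m+1) * (U ((0,0), z) - u1 z) = 0 := by
    filter_upwards [t0.eventually hT, hgd] with z h1 h2
    simp only [zero_add] at h1
    rw [h2] at h1
    linarith
  obtain ⟨hC0, hU0⟩ := LG.coef_unique (m+1) (fun i => C i (0,0)) _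
    (hUz.continuousAt.sub hu1) e0
  have hU0' : U 0 ≠ 0 := by
    have : U ((0,0),0) = u1 0 := by
      simp only [Pi.sub_apply] at hU0
      linarith
    change U ((0,0),0) ≠ 0
    rw [this]; exact hu10
  have hCm : fderiv ℝ (C m) 0 (0, 1) = (m+1) * U 0 := by
    have hdU : AnalyticAt ℝ (fderiv ℝ U) 0 := hU.fderiv
    set D : ℝ → ℝ := fun z => fderiv ℝ U ((0,0),z) ((0,1), 0) - fderiv ℝ U ((0,0),z) ((0,0),1)
      with hD
    have hDc : ContinuousAt D 0 := by
      have : ContinuousAt (fun z : ℝ => fderiv ℝ U ((0,0),z)) 0 :=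
        ContinuousAt.comp (g := fderiv ℝ U) (f := fun z : ℝ => (((0:V), (0:ℝ)), z))
          hdU.continuousAt (by fun_prop)
      exact (this.clm_apply continuousAt_const).sub (this.clm_apply continuousAt_const)
    have hUd : ∀ᶠ q in 𝓝 (0 : (V × ℝ) × ℝ), DifferentiableAt ℝ U q := by
      filter_upwards [hU.eventually_analyticAt] with q hq using hq.differentiableAt
    have hgd' : ∀ᶠ q in 𝓝 (0 : V × ℝ), DifferentiableAt ℝ g q := by
      filter_upwards [hg.eventually_analyticAt] with q hq using hq.differentiableAt
    have t1 : Tendsto (fun z : ℝ => ((0:V), z)) (𝓝 0) (𝓝 0) := by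
      have : ContinuousAt (fun z : ℝ => ((0:V), z)) 0 := by fun_prop
      exact this.tendsto
    have t2 : Tendsto (fun q : ℝ × ℝ => (((0:V), q.2), q.1)) (𝓝 0 ×ˢ 𝓝 0) (𝓝 0) := by
      rw [← nhds_prod_eq]
      have : ContinuousAt (fun q : ℝ × ℝ => (((0:V), q.2), q.1)) (0,0) := by fun_prop
      exact this.tendsto
    have a1 := (t2.eventually hT).curry
    have a2 := (t0.eventually hT).eventually_nhds
    have key : ∀ᶠ z in 𝓝 (0:ℝ), ∑ i ∈ Finset.range m, fderiv ℝ (C i) 0 (0,1) * z ^ i +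
        z ^ m * (fderiv ℝ (C m) 0 (0,1) + z * D z - (m+1) * U ((0,0),z)) = 0 := by
      filter_upwards [a1, a2, t0.eventually hUd, t1.eventually hgd'] with z b1 b2 b3 b4
      have hgz : DifferentiableAt ℝ (fun z : ℝ => g (0, z)) z :=
        DifferentiableAt.comp (g := g) (f := fun z : ℝ => ((0:V), z)) z b4 (by fun_prop)
      have c0 := hgz.hasDerivAt
      set G := deriv (fun z : ℝ => g (0, z)) z
      have c1 : HasDerivAt (fun s : ℝ => g (0, s + z)) G 0 := by
        have : HasDerivAt (fun z : ℝ => g (0, z)) G (0 + z) := by simpa using c0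
        exact HasDerivAt.comp_add_const (0:ℝ) z this
      have c2 : HasDerivAt (fun s : ℝ => ∑ i ∈ Finset.range (m+1), C i (0,s) * z ^ i +
          z ^ (m+1) * U ((0,s), z)) (∑ i ∈ Finset.range (m+1), fderiv ℝ (C i) 0 (0,1) * z ^ i +
          z ^ (m+1) * fderiv ℝ U ((0,0),z) ((0,1),0)) 0 := by
        have hs : HasDerivAt (fun s : ℝ => ((0:V), s)) ((0:V),(1:ℝ)) 0 :=
          (hasDerivAt_const _ _).prodMk (hasDerivAt_id _)
        have hs2 : HasDerivAt (fun s : ℝ => (((0:V), s), z)) (((0:V),(1:ℝ)),(0:ℝ)) 0 :=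
          hs.prodMk (hasDerivAt_const _ _)
        refine HasDerivAt.add (HasDerivAt.fun_sum fun i _ => ?_) ?_
        · refine HasDerivAt.mul_const ?_ _
          exact HasFDerivAt.comp_hasDerivAt (l := C i) (f := fun s : ℝ => ((0:V), s)) (0:ℝ)
            ((hC i).differentiableAt.hasFDerivAt) hs
        · refine HasDerivAt.const_mul _ ?_
          exact HasFDerivAt.comp_hasDerivAt (l := U) (f := fun s : ℝ => (((0:V), s), z)) (0:ℝ)
            (b3.hasFDerivAt) hs2
      have c3 := c2.congr_of_eventuallyEq (f₁ := fun s : ℝ => g (0, s + z)) (by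
        filter_upwards [b1] with s hs using hs)
      have d1 := c1.unique c3
      have c4 : HasDerivAt (fun y : ℝ => y ^ (m+1) * U ((0,0), y))
          (((m+1 : ℕ) : ℝ) * z ^ m * U ((0,0),z) + z ^ (m+1) * fderiv ℝ U ((0,0),z) ((0,0),1)) z := by
        have hs2 : HasDerivAt (fun s : ℝ => (((0:V), (0:ℝ)), s)) (((0:V),(0:ℝ)),(1:ℝ)) z :=
          (hasDerivAt_const _ _).prodMk (hasDerivAt_id _)
        have := HasFDerivAt.comp_hasDerivAt (l := U) (f := fun s : ℝ => (((0:V), (0:ℝ)), s)) z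
            (b3.hasFDerivAt) hs2
        exact (hasDerivAt_pow (m+1) z).mul this
      have c5 := c4.congr_of_eventuallyEq (f₁ := fun y : ℝ => g (0, y)) (by
        filter_upwards [b2] with y hy
        simp only [zero_add] at hy
        rw [hy]
        have : ∑ i ∈ Finset.range (m+1), C i (0,0) * y ^ i = 0 :=
          Finset.sum_eq_zero fun i hi => by
            have := hC0 i (Finset.mem_range.1 hi)
            rw [this, zero_mul]
        rw [this, zero_add])
      have d2 := c0.unique c5
      rw [d2, Finset.sum_range_succ] at d1
      push_cast at d1
      simp only [hD]
      ring_nf at d1 ⊢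
      linarith
    have hWc : ContinuousAt (fun z : ℝ => fderiv ℝ (C m) 0 (0,1) + z * D z - (m+1) * U ((0,0),z)) 0 :=
      (continuousAt_const.add (continuousAt_id.mul hDc)).sub
        (continuousAt_const.mul hUz.continuousAt)
    have := (LG.coef_unique m (fun i => fderiv ℝ (C i) 0 (0,1)) _ hWc key).2
    simp only [zero_mul, add_zero] at this
    change _ = (m+1) * U ((0,0),0)
    linarith
  obtain ⟨h, ha, h0, hz⟩ := LG.ift (C m) (hC m) (hC0 m (Nat.lt_succ_self m)) (by
    rw [hCm]
    exact mul_ne_zero (by positivity) hU0')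
  refine ⟨h, ha, h0, fun i x => C i (x, h x), fun i => ?_, fun i hi => ?_,
    fun p => U ((p.1, h p.1), p.2), ?_, ?_, ?_⟩
  · refine AnalyticAt.fun_comp (g := C i) (f := fun x => (x, h x)) ?_ (by fun_prop)
    rw [h0]; exact hC i
  · simp only [h0]; exact hC0 i (by omega)
  · have h3 : AnalyticAt ℝ (fun p : V × ℝ => h p.1) 0 :=
      AnalyticAt.fun_comp (g := h) (f := Prod.fst) ha (by fun_prop)
    refine AnalyticAt.fun_comp (g := U) (f := fun p : V × ℝ => ((p.1, h p.1), p.2)) ?_ (by fun_prop)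
    simp only [Prod.fst_zero, Prod.snd_zero, h0]; exact hU
  · simp only [Prod.fst_zero, Prod.snd_zero, h0]; exact hU0'
  · have t3 : Tendsto (fun p : V × ℝ => ((p.1, h p.1), p.2)) (𝓝 0) (𝓝 0) := by
      have h3 : ContinuousAt (fun p : V × ℝ => h p.1) 0 :=
        ContinuousAt.comp (g := h) (f := Prod.fst) ha.continuousAt (by fun_prop)
      have : ContinuousAt (fun p : V × ℝ => ((p.1, h p.1), p.2)) 0 := by fun_prop
      have := this.tendsto
      simp only [Prod.fst_zero, Prod.snd_zero, h0] at this
      exact this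
    have t4 : Tendsto (fun p : V × ℝ => p.1) (𝓝 0) (𝓝 0) := by
      have : ContinuousAt (fun p : V × ℝ => p.1) 0 := by fun_prop
      exact this.tendsto
    filter_upwards [t3.eventually hT, t4.eventually hz] with p h1 h2
    rw [add_comm p.2, h1, Finset.sum_range_succ, h2]
    ring

section
variable {E F G : Type*} [NormedAddCommGroup E] [NormedSpace ℝ E]
  [NormedAddCommGroup F] [NormedSpace ℝ F] [NormedAddCommGroup G] [NormedSpace ℝ G]
  {ι κ : Type*} [Fintype ι] [Fintype κ]

/-- `f` is a monomial times a unit near `0`, in the coordinates `l`. -/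
def LG.Mono (l : ι → E →L[ℝ] ℝ) (f : E → ℝ) : Prop :=
  ∃ α : ι → ℕ, ∃ u : E → ℝ, AnalyticAt ℝ u 0 ∧ u 0 ≠ 0 ∧
    ∀ᶠ x in 𝓝 (0 : E), f x = (∏ i, l i x ^ α i) * u x

/-- admissible pull-back of an ultrafilter along a germ of analytic map -/
def LG.Adm (φ : E → F) (𝒱 : Ultrafilter E) (𝒰 : Ultrafilter F) : Prop :=
  AnalyticAt ℝ φ 0 ∧ φ 0 = 0 ∧ (𝒱 : Filter E) ≤ 𝓝 0 ∧ 𝒱.map φ = 𝒰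

def LG.Uz (l : ι → E →L[ℝ] ℝ) (f : E → ℝ) (𝒰 : Ultrafilter E) : Prop :=
  ∃ (φ : E → E) (𝒱 : Ultrafilter E), LG.Adm φ 𝒱 𝒰 ∧ LG.Mono l (fun x => f (φ x))

theorem LG.tend {φ : E → F} (h : AnalyticAt ℝ φ 0) (h0 : φ 0 = 0) : Tendsto φ (𝓝 0) (𝓝 0) := by
  have := h.continuousAt.tendsto
  rwa [h0] at this

theorem LG.an_comp {f : F → G} {φ : E → F} (hf : AnalyticAt ℝ f 0) (h : AnalyticAt ℝ φ 0)
    (h0 : φ 0 = 0) : AnalyticAt ℝ (fun x => f (φ x)) 0 :=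
  AnalyticAt.fun_comp (g := f) (f := φ) (by rw [h0]; exact hf) h

theorem LG.Adm.comp {φ : E → F} {ψ : F → G} {𝒱 : Ultrafilter E} {𝒰 : Ultrafilter F}
    {𝒲 : Ultrafilter G} (h2 : LG.Adm ψ 𝒰 𝒲) (h1 : LG.Adm φ 𝒱 𝒰) :
    LG.Adm (fun x => ψ (φ x)) 𝒱 𝒲 := by
  refine ⟨LG.an_comp h2.1 h1.1 h1.2.1, by simp only [h1.2.1, h2.2.1], h1.2.2.1, ?_⟩
  rw [← h2.2.2.2, ← h1.2.2.2, Ultrafilter.map_map]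
  rfl

theorem LG.Adm.id {𝒰 : Ultrafilter E} (h : (𝒰 : Filter E) ≤ 𝓝 0) : LG.Adm (fun x : E => x) 𝒰 𝒰 :=
  ⟨analyticAt_id, rfl, h, Ultrafilter.map_id 𝒰⟩

theorem LG.Adm.ev {φ : E → F} {𝒱 : Ultrafilter E} {𝒰 : Ultrafilter F} (h : LG.Adm φ 𝒱 𝒰)
    {p : F → Prop} : (∀ᶠ x in (𝒱 : Filter E), p (φ x)) ↔ ∀ᶠ y in (𝒰 : Filter F), p y := by
  rw [← h.2.2.2]; rfl

theorem LG.Adm.le {φ : E → F} {𝒱 : Ultrafilter E} {𝒰 : Ultrafilter F} (h : LG.Adm φ 𝒱 𝒰) :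
    (𝒰 : Filter F) ≤ 𝓝 0 := by
  rw [← h.2.2.2]
  exact (LG.tend h.1 h.2.1).mono_left h.2.2.1

variable {l : ι → E →L[ℝ] ℝ} {l' : κ → F →L[ℝ] ℝ} {f g : E → ℝ} {𝒰 𝒱 : Ultrafilter E}

theorem LG.Mono.congr (h : LG.Mono l f) (hfg : ∀ᶠ x in 𝓝 (0 : E), g x = f x) : LG.Mono l g := by
  obtain ⟨α, u, hu, hu0, h⟩ := h
  refine ⟨α, u, hu, hu0, ?_⟩
  filter_upwards [h, hfg] with x h1 h2
  rw [h2, h1]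

theorem LG.Mono.unit (hf : AnalyticAt ℝ f 0) (h0 : f 0 ≠ 0) : LG.Mono l f :=
  ⟨fun _ => 0, f, hf, h0, by simp⟩

theorem LG.Mono.coord (i : ι) : LG.Mono l (fun x => l i x) := by
  classical
  refine ⟨fun j => if j = i then 1 else 0, fun _ => 1, analyticAt_const, one_ne_zero, ?_⟩
  refine Eventually.of_forall fun x => ?_
  rw [Finset.prod_eq_single i]
  · simp
  · intro j _ hj; simp [hj]
  · simp

theorem LG.Mono.mul (hf : LG.Mono l f) (hg : LG.Mono l g) : LG.Mono l (fun x => f x * g x) := by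
  obtain ⟨α, u, hu, hu0, h⟩ := hf
  obtain ⟨β, v, hv, hv0, h'⟩ := hg
  refine ⟨fun i => α i + β i, fun x => u x * v x, hu.fun_mul hv, mul_ne_zero hu0 hv0, ?_⟩
  filter_upwards [h, h'] with x h1 h2
  simp only [h1, h2, pow_add, Finset.prod_mul_distrib]
  ring

theorem LG.Mono.pow (hf : LG.Mono l f) (k : ℕ) : LG.Mono l (fun x => f x ^ k) := by
  induction k with
  | zero => simpa using LG.Mono.unit (l := l) (f := fun _ => (1:ℝ)) analyticAt_const one_ne_zero
  | succ k ih => simpa only [pow_succ] using ih.mul hf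

theorem LG.Mono.prod {σ : Type*} (s : Finset σ) (F : σ → E → ℝ) (hF : ∀ i ∈ s, LG.Mono l (F i)) :
    LG.Mono l (fun x => ∏ i ∈ s, F i x) := by
  classical
  induction s using Finset.induction_on with
  | empty => simpa using LG.Mono.unit (l := l) (f := fun _ => (1:ℝ)) analyticAt_const one_ne_zero
  | insert a s ha ih =>
    simp only [Finset.prod_insert ha]
    exact (hF a (Finset.mem_insert_self _ _)).mul
      (ih fun i hi => hF i (Finset.mem_insert_of_mem hi))

theorem LG.Mono.comp {h : F → ℝ} (hh : LG.Mono l' h) {φ : E → F} (hφ : AnalyticAt ℝ φ 0)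
    (h0 : φ 0 = 0) (hm : ∀ i, LG.Mono l (fun x => l' i (φ x))) :
    LG.Mono l (fun x => h (φ x)) := by
  obtain ⟨α, u, hu, hu0, h1⟩ := hh
  refine LG.Mono.congr (f := fun x => (∏ i, l' i (φ x) ^ α i) * u (φ x)) ?_
    ((LG.tend hφ h0).eventually h1)
  exact (LG.Mono.prod _ _ fun i _ => (hm i).pow _).mul
    (LG.Mono.unit (LG.an_comp hu hφ h0) (by rw [h0]; exact hu0))

theorem LG.Mono.analyticAt (h : LG.Mono l f) : AnalyticAt ℝ f 0 := by
  obtain ⟨α, u, hu, hu0, h1⟩ := h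
  have : AnalyticAt ℝ (fun x => (∏ i, l i x ^ α i) * u x) 0 := by
    have : ∀ i, AnalyticAt ℝ (fun x => l i x) 0 := fun i => (l i).analyticAt 0
    fun_prop
  exact this.congr (h1.mono fun x hx => hx.symm)

theorem LG.Uz.comp (h : LG.Uz l (fun x => f (φ x)) 𝒱) (hA : LG.Adm φ 𝒱 𝒰) : LG.Uz l f 𝒰 := by
  obtain ⟨ψ, 𝒲, h1, h2⟩ := h
  exact ⟨_, 𝒲, hA.comp h1, h2⟩

theorem LG.Uz.congr (h : LG.Uz l f 𝒰) (hfg : ∀ᶠ x in 𝓝 (0 : E), g x = f x) : LG.Uz l g 𝒰 := by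
  obtain ⟨ψ, 𝒲, h1, h2⟩ := h
  exact ⟨_, 𝒲, h1, h2.congr ((LG.tend h1.1 h1.2.1).eventually hfg)⟩

theorem LG.Uz.of_mono (h : LG.Mono l f) (h𝒰 : (𝒰 : Filter E) ≤ 𝓝 0) : LG.Uz l f 𝒰 :=
  ⟨_, 𝒰, LG.Adm.id h𝒰, h⟩

theorem LG.cancel {a b : E → ℝ} (hf : AnalyticAt ℝ f 0) (ha : AnalyticAt ℝ a 0)
    (hb : AnalyticAt ℝ b 0) (hf0 : ¬ ∀ᶠ x in 𝓝 (0:E), f x = 0)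
    (h : ∀ᶠ x in 𝓝 (0:E), f x * a x = f x * b x) : ∀ᶠ x in 𝓝 (0:E), a x = b x := by
  have := LG.domain hf (ha.fun_sub hb) (by
    filter_upwards [h] with x hx
    rw [mul_sub, hx, sub_self])
  rcases this with h | h
  · exact absurd h hf0
  · filter_upwards [h] with x hx using sub_eq_zero.1 hx

theorem LG.clm_ne (l : E →L[ℝ] ℝ) (h : l ≠ 0) : ¬ ∀ᶠ x in 𝓝 (0:E), l x = 0 := by
  intro h1
  apply h
  ext x
  have t : Tendsto (fun s : ℝ => s • x) (𝓝[≠] 0) (𝓝 0) := by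
    have : ContinuousAt (fun s : ℝ => s • x) 0 := by fun_prop
    have := this.tendsto
    rw [zero_smul] at this
    exact this.mono_left nhdsWithin_le_nhds
  obtain ⟨s, hs, hs0⟩ := ((t.eventually h1).and eventually_mem_nhdsWithin).exists
  rw [map_smul, smul_eq_mul] at hs
  simpa using (mul_eq_zero.1 hs).resolve_left hs0

end

/-- coordinates on `ι → ℝ` -/
def LG.pr (ι : Type*) [Fintype ι] : ι → (ι → ℝ) →L[ℝ] ℝ := fun i => ContinuousLinearMap.proj i

theorem LG.pr_ne {ι : Type*} [Fintype ι] (i : ι) : LG.pr ι i ≠ 0 := by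
  classical
  intro h
  have := congrArg (fun L => L (Pi.single i 1)) h
  simp [LG.pr] at this

theorem LG.factor_aux {ι : Type*} [Fintype ι] (N : ℕ) : ∀ (γ : ι → ℕ), ∑ i, γ i = N →
    ∀ (f g u : (ι → ℝ) → ℝ), AnalyticAt ℝ f 0 → AnalyticAt ℝ g 0 → AnalyticAt ℝ u 0 → u 0 ≠ 0 →
    (∀ᶠ x in 𝓝 (0 : ι → ℝ), f x * g x = (∏ i, x i ^ γ i) * u x) → LG.Mono (LG.pr ι) f := by
  classical
  induction N with
  | zero =>
    intro γ hγ f g u hf hg hu hu0 h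
    have h0 : ∀ i, γ i = 0 := by simpa using hγ
    have := h.self_of_nhds
    simp [h0] at this
    refine LG.Mono.unit hf fun hf0 => hu0 ?_
    rw [← this, hf0, zero_mul]
  | succ N ih =>
    intro γ hγ f g u hf hg hu hu0 h
    obtain ⟨j, hj⟩ : ∃ j, γ j ≠ 0 := by
      by_contra! hh
      simp [hh] at hγ
    set P : (ι → ℝ) →L[ℝ] (ι → ℝ) := ContinuousLinearMap.id ℝ _ -
      (LG.pr ι j).smulRight (Pi.single j 1) with hPdef
    have hP : ∀ x, P x = x - (LG.pr ι j x) • Pi.single j 1 := by intro x; simp [hPdef]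
    have hPj : ∀ x, P x j = 0 := by intro x; simp [hP, LG.pr]
    have hPt : Tendsto P (𝓝 0) (𝓝 0) := LG.tend (P.analyticAt 0) (map_zero P)
    obtain ⟨Gf, hGf, hf1⟩ := LG.division (LG.pr ι j) _ P hP f hf
    obtain ⟨Gg, hGg, hg1⟩ := LG.division (LG.pr ι j) _ P hP g hg
    have hdom := LG.domain (LG.an_comp hf (P.analyticAt 0) (map_zero P))
      (LG.an_comp hg (P.analyticAt 0) (map_zero P)) (by
        filter_upwards [hPt.eventually h] with x hx
        rw [hx, Finset.prod_eq_zero (Finset.mem_univ j), zero_mul]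
        rw [hPj, zero_pow hj])
    set γ' : ι → ℕ := Function.update γ j (γ j - 1) with hγ'
    have hmon : ∀ x : ι → ℝ, ∏ i, x i ^ γ i = x j * ∏ i, x i ^ γ' i := by
      intro x
      rw [← Finset.mul_prod_erase _ _ (Finset.mem_univ j),
        ← Finset.mul_prod_erase Finset.univ (fun i => x i ^ γ' i) (Finset.mem_univ j), ← mul_assoc]
      congr 1
      · simp only [hγ', Function.update_self]
        rw [← pow_succ']; congr 1; omega
      · refine Finset.prod_congr rfl fun i hi => ?_
        rw [hγ', Function.update_of_ne (Finset.ne_of_mem_erase hi)]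
    have hsum : ∑ i, γ' i = N := by
      rw [← Finset.add_sum_erase _ _ (Finset.mem_univ j)] at hγ ⊢
      have : ∑ i ∈ Finset.univ.erase j, γ' i = ∑ i ∈ Finset.univ.erase j, γ i := by
        refine Finset.sum_congr rfl fun i hi => ?_
        rw [hγ', Function.update_of_ne (Finset.ne_of_mem_erase hi)]
      rw [this]
      simp only [hγ', Function.update_self]
      omega
    have hR : AnalyticAt ℝ (fun x : ι → ℝ => (∏ i, x i ^ γ' i) * u x) 0 := by fun_prop
    rcases hdom with h1 | h1
    · have hfe : ∀ᶠ x in 𝓝 (0 : ι → ℝ), f x = LG.pr ι j x * Gf x := by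
        filter_upwards [h1, hf1] with x a b
        rw [b, a, zero_add]
      have := LG.cancel ((LG.pr ι j).analyticAt 0) (hGf.fun_mul hg) hR
        (LG.clm_ne _ (LG.pr_ne j)) (by
          filter_upwards [hfe, h] with x a b
          rw [a, hmon] at b
          change _ = x j * _
          rw [← mul_assoc, b, mul_assoc])
      exact ((LG.Mono.coord j).mul (ih γ' hsum Gf g u hGf hg hu hu0 this)).congr hfe
    · have hge : ∀ᶠ x in 𝓝 (0 : ι → ℝ), g x = LG.pr ι j x * Gg x := by
        filter_upwards [h1, hg1] with x a b
        rw [b, a, zero_add]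
      have := LG.cancel ((LG.pr ι j).analyticAt 0) (hf.fun_mul hGg) hR
        (LG.clm_ne _ (LG.pr_ne j)) (by
          filter_upwards [hge, h] with x a b
          rw [a, hmon] at b
          change _ = x j * _
          rw [← mul_assoc (x j), ← b]; ring)
      exact ih γ' hsum f Gg u hf hGg hu hu0 this

theorem LG.factor {ι : Type*} [Fintype ι] {f g : (ι → ℝ) → ℝ} (hf : AnalyticAt ℝ f 0)
    (hg : AnalyticAt ℝ g 0) (h : LG.Mono (LG.pr ι) (fun x => f x * g x)) :
    LG.Mono (LG.pr ι) f := by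
  obtain ⟨γ, u, hu, hu0, h⟩ := h
  exact LG.factor_aux _ γ rfl f g u hf hg hu hu0 h

theorem LG.order_aux {A B C : ℝ → ℝ} (hA : ContinuousAt A 0) (hB : ContinuousAt B 0)
    (hC : ContinuousAt C 0) (hA0 : A 0 ≠ 0) {p q r : ℕ} (hq : p < q) (hr : p < r)
    (h : ∀ᶠ t in 𝓝 (0:ℝ), t ^ p * A t = t ^ q * B t + t ^ r * C t) : False := by
  obtain ⟨q', rfl⟩ := Nat.exists_eq_add_of_lt hq
  obtain ⟨r', rfl⟩ := Nat.exists_eq_add_of_lt hr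
  have h1 : ∀ᶠ t in 𝓝[≠] (0:ℝ), A t - t ^ (q'+1) * B t - t ^ (r'+1) * C t = 0 := by
    filter_upwards [h.filter_mono nhdsWithin_le_nhds, self_mem_nhdsWithin] with t ht ht0
    have : t ^ p * (A t - t ^ (q'+1) * B t - t ^ (r'+1) * C t) = 0 := by
      have e1 : t ^ (p + q' + 1) = t ^ p * t ^ (q'+1) := by ring
      have e2 : t ^ (p + r' + 1) = t ^ p * t ^ (r'+1) := by ring
      rw [e1, e2] at ht
      linear_combination ht
    exact (mul_eq_zero.1 this).resolve_left (pow_ne_zero _ ht0)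
  have hc : ContinuousAt (fun t => A t - t ^ (q'+1) * B t - t ^ (r'+1) * C t) 0 := by fun_prop
  have h2 := tendsto_nhds_unique (hc.tendsto.mono_left nhdsWithin_le_nhds)
    (tendsto_const_nhds.congr' (h1.mono fun t ht => ht.symm))
  simp at h2
  exact hA0 h2

theorem LG.comparable {ι : Type*} [Fintype ι] (α β : ι → ℕ) (u v : (ι → ℝ) → ℝ)
    (hu : AnalyticAt ℝ u 0) (hv : AnalyticAt ℝ v 0) (hu0 : u 0 ≠ 0) (hv0 : v 0 ≠ 0)
    (h : (∀ᶠ x in 𝓝 (0 : ι → ℝ), (∏ i, x i ^ α i) * u x - (∏ i, x i ^ β i) * v x = 0) ∨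
      LG.Mono (LG.pr ι) (fun x => (∏ i, x i ^ α i) * u x - (∏ i, x i ^ β i) * v x)) :
    α ≤ β ∨ β ≤ α := by
  classical
  by_contra! hcon
  obtain ⟨h1, h2⟩ := hcon
  simp only [Pi.le_def, not_forall, not_le] at h1 h2
  obtain ⟨i, hi⟩ := h1
  obtain ⟨j, hj⟩ := h2
  have curve : ∀ m : ι → ℕ, AnalyticAt ℝ (fun (t : ℝ) (k : ι) => t ^ (m k + 1)) 0 ∧
      (fun (t : ℝ) (k : ι) => t ^ (m k + 1)) 0 = 0 := by
    intro m
    refine ⟨by fun_prop, ?_⟩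
    funext k; simp
  have cp : ∀ (m δ : ι → ℕ) (t : ℝ), ∏ k, (t ^ (m k + 1)) ^ δ k = t ^ (∑ k, (m k + 1) * δ k) := by
    intro m δ t
    simp only [← pow_mul, Finset.prod_pow_eq_pow_sum]
  have cc : ∀ (m : ι → ℕ) (w : (ι → ℝ) → ℝ), AnalyticAt ℝ w 0 → w 0 ≠ 0 →
      ContinuousAt (fun t : ℝ => w (fun k => t ^ (m k + 1))) 0 ∧
      (fun t : ℝ => w (fun k => t ^ (m k + 1))) 0 ≠ 0 := by
    intro m w hw hw0
    refine ⟨(LG.an_comp hw (curve m).1 (curve m).2).continuousAt, ?_⟩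
    have := (curve m).2
    simp only at this ⊢
    rw [this]; exact hw0
  set m1 : ι → ℕ := fun k => if k = i then (∑ k, β k) else 0 with hm1
  set m2 : ι → ℕ := fun k => if k = j then (∑ k, α k) else 0 with hm2
  have s1 : ∀ δ : ι → ℕ, ∑ k, (m1 k + 1) * δ k = (∑ k, β k) * δ i + ∑ k, δ k := by
    intro δ; simp [hm1, add_mul, Finset.sum_add_distrib]
  have s2 : ∀ δ : ι → ℕ, ∑ k, (m2 k + 1) * δ k = (∑ k, α k) * δ j + ∑ k, δ k := by
    intro δ; simp [hm2, add_mul, Finset.sum_add_distrib]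
  have pa : 0 < ∑ k, α k := lt_of_lt_of_le (by omega : 0 < α i)
    (Finset.single_le_sum (fun k _ => Nat.zero_le _) (Finset.mem_univ i))
  have o1 : ∑ k, (m1 k + 1) * β k < ∑ k, (m1 k + 1) * α k := by
    rw [s1, s1]
    have := Nat.mul_le_mul_left (∑ k, β k) (Nat.succ_le_of_lt hi)
    rw [Nat.mul_succ] at this
    omega
  have pb : 0 < ∑ k, β k := lt_of_lt_of_le (by omega : 0 < β j)
    (Finset.single_le_sum (fun k _ => Nat.zero_le _) (Finset.mem_univ j))
  have o2 : ∑ k, (m2 k + 1) * α k < ∑ k, (m2 k + 1) * β k := by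
    rw [s2, s2]
    have := Nat.mul_le_mul_left (∑ k, α k) (Nat.succ_le_of_lt hj)
    rw [Nat.mul_succ] at this
    omega
  rcases h with h | ⟨δ, w, hw, hw0, h⟩
  · have := (LG.tend (curve m1).1 (curve m1).2).eventually h
    refine LG.order_aux (cc m1 v hv hv0).1 (cc m1 u hu hu0).1 (continuousAt_const (y := (0:ℝ)))
      (cc m1 v hv hv0).2 o1 o1 ?_
    filter_upwards [this] with t ht
    rw [cp, cp] at ht
    linarith
  · have key : ∀ m : ι → ℕ, ∀ᶠ t in 𝓝 (0:ℝ),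
        t ^ (∑ k, (m k + 1) * α k) * u (fun k => t ^ (m k + 1)) -
        t ^ (∑ k, (m k + 1) * β k) * v (fun k => t ^ (m k + 1)) =
        t ^ (∑ k, (m k + 1) * δ k) * w (fun k => t ^ (m k + 1)) := by
      intro m
      filter_upwards [(LG.tend (curve m).1 (curve m).2).eventually h] with t ht
      simp only [LG.pr, ContinuousLinearMap.proj_apply] at ht
      rw [cp, cp, cp] at ht
      exact ht
    have r1 : ∑ k, (m1 k + 1) * δ k ≤ ∑ k, (m1 k + 1) * β k := by
      by_contra! hlt
      refine LG.order_aux (cc m1 v hv hv0).1 (cc m1 u hu hu0).1 (cc m1 w hw hw0).1.neg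
        (cc m1 v hv hv0).2 o1 hlt ?_
      filter_upwards [key m1] with t ht
      simp only [Pi.neg_apply]
      linarith
    have r2 : ∑ k, (m2 k + 1) * δ k ≤ ∑ k, (m2 k + 1) * α k := by
      by_contra! hlt
      refine LG.order_aux (cc m2 u hu hu0).1 (cc m2 v hv hv0).1 (cc m2 w hw hw0).1
        (cc m2 u hu hu0).2 o2 hlt ?_
      filter_upwards [key m2] with t ht
      linarith
    set m : ι → ℕ := fun k => m1 k + m2 k + 1 with hm
    have s : ∀ δ : ι → ℕ, ∑ k, (m k + 1) * δ k =
        ∑ k, (m1 k + 1) * δ k + ∑ k, (m2 k + 1) * δ k := by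
      intro δ
      rw [← Finset.sum_add_distrib]
      refine Finset.sum_congr rfl fun k _ => ?_
      simp only [hm]; ring
    refine LG.order_aux (cc m w hw hw0).1 (cc m u hu hu0).1 (cc m v hv hv0).1.neg
        (cc m w hw hw0).2 (p := ∑ k, (m k + 1) * δ k) (q := ∑ k, (m k + 1) * α k)
        (r := ∑ k, (m k + 1) * β k) (by rw [s, s]; omega) (by rw [s, s]; omega) ?_
    filter_upwards [key m] with t ht
    simp only [Pi.neg_apply]
    linarith

def LG.MonP (ι : Type*) [Fintype ι] : Prop :=
  ∀ f : (ι → ℝ) → ℝ, AnalyticAt ℝ f 0 → (¬ ∀ᶠ x in 𝓝 (0 : ι → ℝ), f x = 0) →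
    ∀ 𝒰 : Ultrafilter (ι → ℝ), (𝒰 : Filter (ι → ℝ)) ≤ 𝓝 0 → LG.Uz (LG.pr ι) f 𝒰

theorem LG.prod_ne {E σ : Type*} [NormedAddCommGroup E] [NormedSpace ℝ E] (s : Finset σ)
    (F : σ → E → ℝ) (hF : ∀ i, AnalyticAt ℝ (F i) 0)
    (h : ∀ i ∈ s, ¬ ∀ᶠ x in 𝓝 (0 : E), F i x = 0) :
    ¬ ∀ᶠ x in 𝓝 (0 : E), ∏ i ∈ s, F i x = 0 := by
  classical
  induction s using Finset.induction_on with
  | empty => simpa using (inferInstance : (𝓝 (0:E)).NeBot).ne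
  | insert a s ha ih =>
    intro hc
    simp only [Finset.prod_insert ha] at hc
    rcases LG.domain (hF a) (Finset.analyticAt_fun_prod s fun i _ => hF i) hc with h1 | h1
    · exact h a (Finset.mem_insert_self _ _) h1
    · exact ih (fun i hi => h i (Finset.mem_insert_of_mem hi)) h1

theorem LG.family {ι κ : Type*} [Fintype ι] [Fintype κ] (hM : LG.MonP ι)
    (F : κ → (ι → ℝ) → ℝ) (hF : ∀ s, AnalyticAt ℝ (F s) 0) (𝒰 : Ultrafilter (ι → ℝ))
    (h𝒰 : (𝒰 : Filter (ι → ℝ)) ≤ 𝓝 0) :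
    ∃ (φ : (ι → ℝ) → (ι → ℝ)) (𝒱 : Ultrafilter (ι → ℝ)), LG.Adm φ 𝒱 𝒰 ∧
      ∀ s, (∀ᶠ x in 𝓝 (0 : ι → ℝ), F s x = 0) ∨ LG.Mono (LG.pr ι) (fun x => F s (φ x)) := by
  classical
  set S : Finset κ := Finset.univ.filter fun s => ¬ ∀ᶠ x in 𝓝 (0 : ι → ℝ), F s x = 0 with hS
  obtain ⟨φ, 𝒱, hA, hmono⟩ := hM (fun x => ∏ s ∈ S, F s x)
    (Finset.analyticAt_fun_prod S fun i _ => hF i)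
    (LG.prod_ne S F hF fun i hi => (Finset.mem_filter.1 hi).2) 𝒰 h𝒰
  refine ⟨φ, 𝒱, hA, fun s => ?_⟩
  by_cases hs : ∀ᶠ x in 𝓝 (0 : ι → ℝ), F s x = 0
  · exact Or.inl hs
  · right
    have hsS : s ∈ S := Finset.mem_filter.2 ⟨Finset.mem_univ _, hs⟩
    have hFφ : ∀ s, AnalyticAt ℝ (fun x => F s (φ x)) 0 := fun s =>
      LG.an_comp (hF s) hA.1 hA.2.1
    refine LG.factor (hFφ s) (g := fun x => ∏ s ∈ S.erase s, F s (φ x))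
      (Finset.analyticAt_fun_prod _ fun i _ => hFφ i) ?_
    exact hmono.congr (Eventually.of_forall fun x =>
      Finset.mul_prod_erase S (fun s => F s (φ x)) hsS)

theorem LG.powsub {ι : Type*} [Fintype ι] (N : ℕ) (hN : N ≠ 0) (𝒰 : Ultrafilter (ι → ℝ))
    (h𝒰 : (𝒰 : Filter (ι → ℝ)) ≤ 𝓝 0) :
    ∃ (σ : ι → ℝ) (𝒱 : Ultrafilter (ι → ℝ)), (∀ i, σ i ≠ 0) ∧
      LG.Adm (fun w i => σ i * w i ^ N) 𝒱 𝒰 := by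
  have : ∀ i, ∃ s : ℝ, s ≠ 0 ∧ ∀ᶠ y in (𝒰 : Filter (ι → ℝ)), s * |y i| = y i := by
    intro i
    rcases 𝒰.mem_or_compl_mem {y | 0 ≤ y i} with h | h
    · refine ⟨1, one_ne_zero, ?_⟩
      filter_upwards [h] with y hy
      rw [one_mul, abs_of_nonneg hy]
    · refine ⟨-1, by norm_num, ?_⟩
      filter_upwards [h] with y hy
      have : y i < 0 := not_le.1 hy
      rw [abs_of_neg this]; ring
  choose σ hσ0 hσ using this
  set ψ : (ι → ℝ) → (ι → ℝ) := fun y i => |y i| ^ ((N:ℝ)⁻¹) with hψ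
  have hN' : (N:ℝ)⁻¹ ≠ 0 := inv_ne_zero (Nat.cast_ne_zero.2 hN)
  refine ⟨σ, 𝒰.map ψ, hσ0, by fun_prop, ?_, ?_, ?_⟩
  · funext i; simp [hN]
  · have hc : Continuous ψ := by
      refine continuous_pi fun i => ?_
      exact ((continuous_apply i).abs).rpow_const fun _ => Or.inr (by positivity)
    have := hc.tendsto 0
    have h0 : ψ 0 = 0 := by funext i; simp [hψ, Real.zero_rpow hN']
    rw [h0] at this
    exact this.mono_left h𝒰
  · rw [Ultrafilter.map_map]
    have : ∀ᶠ y in (𝒰 : Filter (ι → ℝ)), ((fun w i => σ i * w i ^ N) ∘ ψ) y = y := by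
      filter_upwards [eventually_all.2 hσ] with y hy
      funext i
      simp only [Function.comp, hψ]
      rw [Real.rpow_inv_natCast_pow (abs_nonneg _) hN, hy]
    apply Ultrafilter.coe_injective
    rw [Ultrafilter.coe_map, Filter.map_congr (m₂ := fun y => y) this]
    exact Filter.map_id

theorem LG.prep {ι : Type*} [Fintype ι] (hM : LG.MonP ι) (m : ℕ) (b : (ι → ℝ) → ℝ)
    (c : Fin m → (ι → ℝ) → ℝ) (hb : AnalyticAt ℝ b 0)
    (hb0 : ¬ ∀ᶠ x in 𝓝 (0 : ι → ℝ), b x = 0) (hc : ∀ i, AnalyticAt ℝ (c i) 0)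
    (𝒰 : Ultrafilter (ι → ℝ)) (h𝒰 : (𝒰 : Filter (ι → ℝ)) ≤ 𝓝 0) :
    ∃ (φ : (ι → ℝ) → (ι → ℝ)) (𝒱 : Ultrafilter (ι → ℝ)), LG.Adm φ 𝒱 𝒰 ∧
      LG.Mono (LG.pr ι) (fun x => b (φ x)) ∧
      ((∀ i, ∀ᶠ x in 𝓝 (0 : ι → ℝ), c i (φ x) = 0) ∨
       ∃ γ : ι → ℕ, ∃ c' : Fin m → (ι → ℝ) → ℝ, (∀ i, AnalyticAt ℝ (c' i) 0) ∧
        (∀ i, ∀ᶠ x in 𝓝 (0 : ι → ℝ), c i (φ x) = (∏ j, x j ^ γ j) ^ (m + 1 - i.val) * c' i x) ∧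
        ∃ k, c' k 0 ≠ 0) := by
  classical
  set N := (m+1).factorial with hN
  have hN0 : N ≠ 0 := Nat.factorial_ne_zero _
  set e : Fin m → ℕ := fun i => N / (m + 1 - i.val) with he
  have heN : ∀ i, e i * (m + 1 - i.val) = N := fun i =>
    Nat.div_mul_cancel (Nat.dvd_factorial (by omega) (by omega))
  set F : Unit ⊕ (Fin m ⊕ Fin m × Fin m) → (ι → ℝ) → ℝ :=
    Sum.elim (fun _ => b) (Sum.elim c (fun p x => c p.1 x ^ e p.1 - c p.2 x ^ e p.2)) with hF
  obtain ⟨φ, 𝒱, hA, H⟩ := LG.family hM F (by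
    rintro (_ | i | ⟨i, j⟩)
    · exact hb
    · exact hc i
    · exact ((hc i).fun_pow _).fun_sub ((hc j).fun_pow _)) 𝒰 h𝒰
  have hφt := LG.tend hA.1 hA.2.1
  have Hb : LG.Mono (LG.pr ι) (fun x => b (φ x)) := (H (Sum.inl ())).resolve_left hb0
  by_cases hall : ∀ i, ∀ᶠ x in 𝓝 (0 : ι → ℝ), c i x = 0
  · exact ⟨φ, 𝒱, hA, Hb, Or.inl fun i => hφt.eventually (hall i)⟩
  have Hc : ∀ i : Fin m, ∃ (α : ι → ℕ) (u : (ι → ℝ) → ℝ), AnalyticAt ℝ u 0 ∧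
      (∀ᶠ x in 𝓝 (0 : ι → ℝ), c i (φ x) = (∏ j, x j ^ α j) * u x) ∧
      ((∀ᶠ x in 𝓝 (0 : ι → ℝ), c i x = 0) → u = fun _ => 0) ∧
      ((¬ ∀ᶠ x in 𝓝 (0 : ι → ℝ), c i x = 0) → u 0 ≠ 0) := by
    intro i
    by_cases h : ∀ᶠ x in 𝓝 (0 : ι → ℝ), c i x = 0
    · refine ⟨fun _ => 0, fun _ => 0, analyticAt_const, ?_, fun _ => rfl, fun h' => absurd h h'⟩
      simpa using hφt.eventually h
    · obtain ⟨α, u, hu, hu0, h1⟩ := (H (Sum.inr (Sum.inl i))).resolve_left h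
      exact ⟨α, u, hu, h1, fun h' => absurd h' h, fun _ => hu0⟩
  choose α u hu hcu huz hu0 using Hc
  set S : Finset (Fin m) := Finset.univ.filter fun i => ¬ ∀ᶠ x in 𝓝 (0 : ι → ℝ), c i x = 0 with hS
  have hSne : S.Nonempty := by
    obtain ⟨i, hi⟩ := not_forall.1 hall
    exact ⟨i, Finset.mem_filter.2 ⟨Finset.mem_univ _, hi⟩⟩
  obtain ⟨k, hkS, hkmin⟩ := Finset.exists_min_image S (fun i => ∑ j, e i * α i j) hSne
  have hpow : ∀ i, ∀ᶠ x in 𝓝 (0 : ι → ℝ), c i (φ x) ^ e i =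
      (∏ j, x j ^ (e i * α i j)) * u i x ^ e i := by
    intro i
    filter_upwards [hcu i] with x hx
    rw [hx, mul_pow, ← Finset.prod_pow]
    simp only [← pow_mul, mul_comm]
  have hle : ∀ i ∈ S, ∀ j, e k * α k j ≤ e i * α i j := by
    intro i hi
    have hi' := (Finset.mem_filter.1 hi).2
    have hk' := (Finset.mem_filter.1 hkS).2
    have hcomp := LG.comparable (fun j => e i * α i j) (fun j => e k * α k j)
      (fun x => u i x ^ e i) (fun x => u k x ^ e k) ((hu i).fun_pow _) ((hu k).fun_pow _)
      (pow_ne_zero _ (hu0 i hi')) (pow_ne_zero _ (hu0 k hk')) (by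
        rcases H (Sum.inr (Sum.inr (i, k))) with h | h
        · left
          filter_upwards [hφt.eventually h, hpow i, hpow k] with x h1 h2 h3
          rw [← h2, ← h3]; exact h1
        · right
          refine h.congr ?_
          filter_upwards [hpow i, hpow k] with x h2 h3
          rw [← h2, ← h3]; rfl)
    rcases hcomp with h | h
    · have hs := hkmin i hi
      have hs2 := Finset.sum_le_sum (s := Finset.univ) (fun j _ => h j)
      have heq := (Finset.sum_eq_sum_iff_of_le (s := Finset.univ) (fun j _ => h j)).1
        (le_antisymm hs2 hs)
      intro j
      exact (heq j (Finset.mem_univ j)).ge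
    · exact h
  obtain ⟨σ, 𝒲, hσ, hB⟩ := LG.powsub N hN0 𝒱 hA.2.2.1
  set ψ : (ι → ℝ) → (ι → ℝ) := fun w i => σ i * w i ^ N with hψ
  have hψt := LG.tend hB.1 hB.2.1
  refine ⟨_, 𝒲, hA.comp hB, ?_, Or.inr ⟨fun j => e k * α k j, fun i w =>
    (∏ j, w j ^ (N * α i j - (m+1-i.val) * (e k * α k j))) *
      ((∏ j, σ j ^ α i j) * u i (ψ w)), ?_, ?_, k, ?_⟩⟩
  · refine Hb.comp hB.1 hB.2.1 fun i => ?_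
    exact (LG.Mono.unit analyticAt_const (hσ i)).mul ((LG.Mono.coord i).pow N)
  · intro i
    have := LG.an_comp (hu i) hB.1 hB.2.1
    exact AnalyticAt.fun_mul (by fun_prop) (analyticAt_const.fun_mul this)
  · intro i
    filter_upwards [hψt.eventually (hcu i)] with w hw
    by_cases hi : ∀ᶠ x in 𝓝 (0 : ι → ℝ), c i x = 0
    · rw [hw, huz i hi]; simp
    · have hiS : i ∈ S := Finset.mem_filter.2 ⟨Finset.mem_univ _, hi⟩
      have e1 : ∏ j, (ψ w j) ^ α i j = (∏ j, σ j ^ α i j) * ∏ j, w j ^ (N * α i j) := by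
        simp only [hψ, mul_pow, Finset.prod_mul_distrib, ← pow_mul]
      have e2 : ∏ j, w j ^ (N * α i j) = (∏ j, w j ^ (e k * α k j)) ^ (m+1-i.val) *
          ∏ j, w j ^ (N * α i j - (m+1-i.val) * (e k * α k j)) := by
        rw [← Finset.prod_pow, ← Finset.prod_mul_distrib]
        refine Finset.prod_congr rfl fun j _ => ?_
        rw [← pow_mul, ← pow_add]
        congr 1
        have := Nat.mul_le_mul_left (m+1-i.val) (hle i hiS j)
        have h2 : (m+1-i.val) * (e i * α i j) = N * α i j := by rw [← heN i]; ring
        rw [h2] at this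
        rw [mul_comm (e k * α k j)]
        omega
      rw [hw, e1, e2]; ring
  · have hk' := (Finset.mem_filter.1 hkS).2
    have h2 : ∀ j, N * α k j - (m+1-k.val) * (e k * α k j) = 0 := by
      intro j
      have : (m+1-k.val) * (e k * α k j) = N * α k j := by rw [← heN k]; ring
      omega
    simp only [h2, pow_zero, Finset.prod_const_one, one_mul, hB.2.1]
    exact mul_ne_zero (Finset.prod_ne_zero_iff.2 fun j _ => pow_ne_zero _ (hσ j)) (hu0 k hk')

section
variable {ι : Type*} [Fintype ι]

/-- coordinates on `(ι → ℝ) × ℝ` -/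
def LG.lo (ι : Type*) [Fintype ι] : Option ι → ((ι → ℝ) × ℝ) →L[ℝ] ℝ := fun o =>
  match o with
  | none => ContinuousLinearMap.snd ℝ (ι → ℝ) ℝ
  | some i => (ContinuousLinearMap.proj i).comp (ContinuousLinearMap.fst ℝ (ι → ℝ) ℝ)

theorem LG.lo_none (p : (ι → ℝ) × ℝ) : LG.lo ι none p = p.2 := rfl

theorem LG.lo_some (i : ι) (p : (ι → ℝ) × ℝ) : LG.lo ι (some i) p = p.1 i := rfl

theorem LG.Mono.z : LG.Mono (LG.lo ι) (fun p => p.2) := LG.Mono.coord (l := LG.lo ι) none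

theorem LG.Mono.w (i : ι) : LG.Mono (LG.lo ι) (fun p => p.1 i) :=
  LG.Mono.coord (l := LG.lo ι) (some i)

theorem LG.Mono.lift {f : (ι → ℝ) → ℝ} (h : LG.Mono (LG.pr ι) f) :
    LG.Mono (LG.lo ι) (fun p => f p.1) :=
  LG.Mono.comp (l' := LG.pr ι) (φ := Prod.fst) h analyticAt_fst rfl fun i => LG.Mono.w i

theorem LG.lift_adm {φ : (ι → ℝ) → (ι → ℝ)} {𝒱 : Ultrafilter (ι → ℝ)}
    {𝒰 : Ultrafilter ((ι → ℝ) × ℝ)} (h𝒰 : (𝒰 : Filter ((ι → ℝ) × ℝ)) ≤ 𝓝 0)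
    (h : LG.Adm φ 𝒱 (𝒰.map Prod.fst)) :
    ∃ 𝒲 : Ultrafilter ((ι → ℝ) × ℝ),
      LG.Adm (fun p : (ι → ℝ) × ℝ => (φ p.1, p.2)) 𝒲 𝒰 := by
  set Φ : (ι → ℝ) × ℝ → (ι → ℝ) × ℝ := fun p => (φ p.1, p.2) with hΦ
  have hne : (comap Φ (𝒰 : Filter _) ⊓ comap Prod.fst (𝒱 : Filter (ι → ℝ))).NeBot := by
    rw [Filter.inf_neBot_iff]
    rintro S ⟨S', hS', hS⟩ T ⟨T', hT', hT⟩
    have h1 : Set.image φ T' ∈ 𝒱.map φ := by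
      rw [Ultrafilter.mem_map]
      exact Filter.mem_of_superset hT' (Set.subset_preimage_image φ T')
    rw [h.2.2.2, Ultrafilter.mem_map] at h1
    obtain ⟨⟨x, z⟩, hx1, hx2⟩ := 𝒰.nonempty_of_mem (Filter.inter_mem hS' h1)
    obtain ⟨t, ht, htx⟩ := hx2
    refine ⟨(t, z), hS ?_, hT ht⟩
    simp only at htx
    simp only [hΦ, Set.mem_preimage, htx]
    exact hx1
  set 𝒲 := @Ultrafilter.of _ _ hne with h𝒲
  have hle := @Ultrafilter.of_le _ _ hne
  have hm : 𝒲.map Φ = 𝒰 := by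
    apply Ultrafilter.coe_le_coe.1
    rw [Ultrafilter.coe_map, Filter.map_le_iff_le_comap]
    exact hle.trans inf_le_left
  refine ⟨𝒲, ?_, ?_, ?_, hm⟩
  · have h1 : AnalyticAt ℝ (fun p : (ι → ℝ) × ℝ => φ p.1) 0 :=
      LG.an_comp (φ := Prod.fst) h.1 analyticAt_fst rfl
    exact h1.prod analyticAt_snd
  · simp only [hΦ, Prod.fst_zero, Prod.snd_zero, h.2.1]; rfl
  · have h1 : Tendsto Prod.fst (𝒲 : Filter ((ι → ℝ) × ℝ)) (𝓝 (0 : ι → ℝ)) := by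
      refine le_trans ?_ h.2.2.1
      rw [Filter.map_le_iff_le_comap]
      exact hle.trans inf_le_right
    have h2 : Tendsto Prod.snd (𝒲 : Filter ((ι → ℝ) × ℝ)) (𝓝 (0 : ℝ)) := by
      have h3 : Tendsto Prod.snd (𝒰 : Filter ((ι → ℝ) × ℝ)) (𝓝 (0 : ℝ)) :=
        (continuous_snd.tendsto (0 : (ι → ℝ) × ℝ)).mono_left h𝒰
      rw [← hm, Ultrafilter.coe_map, Filter.tendsto_map'_iff] at h3
      exact h3
    exact h1.prodMk_nhds h2

theorem LG.blowup {m : (ι → ℝ) → ℝ} (hm : AnalyticAt ℝ m 0) (hm0 : m 0 = 0)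
    {𝒰 : Ultrafilter ((ι → ℝ) × ℝ)} (h𝒰 : (𝒰 : Filter ((ι → ℝ) × ℝ)) ≤ 𝓝 0) (R : ℝ)
    (h : ∀ᶠ p in (𝒰 : Filter ((ι → ℝ) × ℝ)), |p.2| ≤ R * |m p.1|) :
    ∃ (a : ℝ) (𝒱 : Ultrafilter ((ι → ℝ) × ℝ)),
      LG.Adm (fun p : (ι → ℝ) × ℝ => (p.1, m p.1 * (p.2 + a))) 𝒱 𝒰 := by
  set q : (ι → ℝ) × ℝ → ℝ := fun p => p.2 / m p.1 with hq
  have hqb : ∀ᶠ p in (𝒰 : Filter ((ι → ℝ) × ℝ)), q p ∈ Set.Icc (-|R|) |R| := by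
    filter_upwards [h] with p hp
    rw [Set.mem_Icc, ← abs_le]
    simp only [hq, abs_div]
    rcases eq_or_ne (m p.1) 0 with h0 | h0
    · simp [h0]
    · rw [div_le_iff₀ (abs_pos.2 h0)]
      exact hp.trans (mul_le_mul_of_nonneg_right (le_abs_self R) (abs_nonneg _))
  obtain ⟨a, -, ha⟩ := isCompact_iff_ultrafilter_le_nhds.1 (isCompact_Icc (a := -|R|) (b := |R|))
    (𝒰.map q) (le_principal_iff.2 hqb)
  refine ⟨a, 𝒰.map (fun p => (p.1, q p - a)), ?_, ?_, ?_, ?_⟩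
  · have h1 : AnalyticAt ℝ (fun p : (ι → ℝ) × ℝ => m p.1) 0 :=
      LG.an_comp (φ := Prod.fst) hm analyticAt_fst rfl
    fun_prop
  · simp [hm0]
  · have h1 : Tendsto Prod.fst (𝒰 : Filter ((ι → ℝ) × ℝ)) (𝓝 (0 : ι → ℝ)) :=
      (continuous_fst.tendsto (0 : (ι → ℝ) × ℝ)).mono_left h𝒰
    have h2 : Tendsto (fun p => q p - a) (𝒰 : Filter ((ι → ℝ) × ℝ)) (𝓝 (a - a)) :=
      Tendsto.sub_const (f := q) ha a
    rw [sub_self] at h2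
    exact h1.prodMk_nhds h2
  · rw [Ultrafilter.map_map]
    apply Ultrafilter.coe_injective
    rw [Ultrafilter.coe_map, Filter.map_congr (m₂ := fun y => y)]
    · exact Filter.map_id
    · filter_upwards [h] with p hp
      simp only [Function.comp, sub_add_cancel, hq]
      rcases eq_or_ne (m p.1) 0 with h0 | h0
      · rw [h0, abs_zero, mul_zero, abs_nonpos_iff] at hp
        ext
        · rfl
        · simp [h0, hp]
      · rw [mul_div_cancel₀ _ h0]

theorem LG.split (N : ℕ) (γ : ι → ℕ) (hγ : ∑ i, γ i = N + 1) : ∃ j, γ j ≠ 0 ∧ ∃ γ' : ι → ℕ,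
    ∑ i, γ' i = N ∧ ∀ x : ι → ℝ, ∏ i, x i ^ γ i = x j * ∏ i, x i ^ γ' i := by
  classical
  obtain ⟨j, hj⟩ : ∃ j, γ j ≠ 0 := by
    by_contra! hh
    simp [hh] at hγ
  refine ⟨j, hj, Function.update γ j (γ j - 1), ?_, ?_⟩
  · rw [← Finset.add_sum_erase _ _ (Finset.mem_univ j)] at hγ ⊢
    have : ∑ i ∈ Finset.univ.erase j, Function.update γ j (γ j - 1) i =
        ∑ i ∈ Finset.univ.erase j, γ i := by
      refine Finset.sum_congr rfl fun i hi => ?_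
      rw [Function.update_of_ne (Finset.ne_of_mem_erase hi)]
    rw [this]
    simp only [Function.update_self]
    omega
  · intro x
    rw [← Finset.mul_prod_erase _ _ (Finset.mem_univ j),
      ← Finset.mul_prod_erase Finset.univ (fun i => x i ^ Function.update γ j (γ j - 1) i)
        (Finset.mem_univ j), ← mul_assoc]
    congr 1
    · simp only [Function.update_self]
      rw [← pow_succ']; congr 1; omega
    · refine Finset.prod_congr rfl fun i hi => ?_
      rw [Function.update_of_ne (Finset.ne_of_mem_erase hi)]

theorem LG.lemT (N : ℕ) : ∀ (γ : ι → ℕ), ∑ i, γ i = N → ∀ 𝒰 : Ultrafilter ((ι → ℝ) × ℝ),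
    (𝒰 : Filter ((ι → ℝ) × ℝ)) ≤ 𝓝 0 →
    (∀ ε : ℝ, 0 < ε → ∀ᶠ p in (𝒰 : Filter ((ι → ℝ) × ℝ)), |∏ i, p.1 i ^ γ i| < ε * |p.2|) →
    ∃ (φ : (ι → ℝ) × ℝ → (ι → ℝ) × ℝ) (𝒱 : Ultrafilter ((ι → ℝ) × ℝ)), LG.Adm φ 𝒱 𝒰 ∧
      (∀ o, LG.Mono (LG.lo ι) (fun p => LG.lo ι o (φ p))) ∧
      ∃ m : (ι → ℝ) × ℝ → ℝ, AnalyticAt ℝ m 0 ∧ m 0 = 0 ∧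
        ∀ᶠ p in 𝓝 (0 : (ι → ℝ) × ℝ), ∏ i, (φ p).1 i ^ γ i = (φ p).2 * m p := by
  classical
  induction N with
  | zero =>
    intro γ hγ 𝒰 h𝒰 H
    exfalso
    have h0 : ∀ i, γ i = 0 := by simpa using hγ
    have h1 : ∀ᶠ p in (𝒰 : Filter ((ι → ℝ) × ℝ)), |p.2| < 1 := by
      have hc : ContinuousAt (fun p : (ι → ℝ) × ℝ => |p.2|) 0 := by fun_prop
      exact h𝒰 (hc.eventually_lt continuousAt_const (by simp))
    obtain ⟨p, hp1, hp2⟩ := (h1.and (H 1 one_pos)).exists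
    simp [h0] at hp2
    linarith
  | succ N ih =>
    intro γ hγ 𝒰 h𝒰 H
    obtain ⟨j, hj, γ', hγ', hmon⟩ := LG.split N γ hγ
    by_cases hR : ∃ R : ℝ, ∀ᶠ p in (𝒰 : Filter ((ι → ℝ) × ℝ)), |p.2| ≤ R * |p.1 j|
    · obtain ⟨R, hR⟩ := hR
      obtain ⟨a, 𝒱, hA⟩ := LG.blowup (m := fun x => x j) (by fun_prop) rfl h𝒰 R hR
      have H' : ∀ ε : ℝ, 0 < ε → ∀ᶠ p in (𝒱 : Filter ((ι → ℝ) × ℝ)),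
          |∏ i, p.1 i ^ γ' i| < ε * |p.2 + a| := by
        intro ε hε
        filter_upwards [hA.ev.2 (H ε hε)] with p hp
        rw [hmon, abs_mul, abs_mul] at hp
        have : |p.1 j| * |∏ i, p.1 i ^ γ' i| < |p.1 j| * (ε * |p.2 + a|) := by linarith
        exact lt_of_mul_lt_mul_left this (abs_nonneg _)
      rcases eq_or_ne a 0 with rfl | ha
      · obtain ⟨φ, 𝒲, hB, hm, m, hma, hm0, hid⟩ := ih γ' hγ' 𝒱 hA.2.2.1 (by simpa using H')
        refine ⟨_, 𝒲, hA.comp hB, ?_, m, hma, hm0, ?_⟩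
        · rintro (_ | i)
          · exact ((hm (some j)).mul (hm none)).congr
              (Eventually.of_forall fun p => by simp [LG.lo_none, LG.lo_some])
          · exact hm (some i)
        · filter_upwards [hid] with p hp
          simp only [hmon, hp, add_zero]
          ring
      · have hae : ∀ᶠ p in 𝓝 (0 : (ι → ℝ) × ℝ), p.2 + a ≠ 0 := by
          have hc : ContinuousAt (fun p : (ι → ℝ) × ℝ => p.2 + a) 0 := by fun_prop
          exact hc.eventually_ne (by simpa using ha)
        have hman : AnalyticAt ℝ (fun p : (ι → ℝ) × ℝ => (∏ i, p.1 i ^ γ' i) * (p.2 + a)⁻¹) 0 := by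
          have h1 : AnalyticAt ℝ (fun p : (ι → ℝ) × ℝ => p.2 + a) 0 := by fun_prop
          exact AnalyticAt.fun_mul (by fun_prop) (h1.fun_inv (by simpa using ha))
        refine ⟨_, 𝒱, hA, ?_, fun p => (∏ i, p.1 i ^ γ' i) * (p.2 + a)⁻¹, hman, ?_, ?_⟩
        · rintro (_ | i)
          · exact (LG.Mono.w j).mul (LG.Mono.unit (by fun_prop) (by simpa using ha))
          · exact LG.Mono.w i
        · have ht : Tendsto (fun p : (ι → ℝ) × ℝ => |(∏ i, p.1 i ^ γ' i) * (p.2 + a)⁻¹|)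
              (𝒱 : Filter ((ι → ℝ) × ℝ)) (𝓝 _) :=
            (hman.continuousAt.tendsto.mono_left hA.2.2.1).abs
          rw [← abs_nonpos_iff]
          refine le_of_forall_pos_le_add fun ε hε => ?_
          rw [zero_add]
          refine le_of_tendsto ht ?_
          filter_upwards [H' ε hε, hA.2.2.1 hae] with p hp hp2
          rw [abs_mul, abs_inv, ← div_eq_mul_inv, div_le_iff₀ (abs_pos.2 hp2)]
          exact hp.le
        · filter_upwards [hae] with p hp
          rw [hmon]
          field_simp
    · push Not at hR
      have hR' : ∀ R : ℝ, ∀ᶠ p in (𝒰 : Filter ((ι → ℝ) × ℝ)), R * |p.1 j| < |p.2| := hR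
      have hz : ∀ᶠ p in (𝒰 : Filter ((ι → ℝ) × ℝ)), p.2 ≠ 0 := by
        filter_upwards [hR' 0] with p hp
        rw [zero_mul] at hp
        exact abs_pos.1 hp
      have hA : LG.Adm (fun p : (ι → ℝ) × ℝ => (Function.update p.1 j (p.2 * p.1 j), p.2))
          (𝒰.map (fun p => (Function.update p.1 j (p.1 j / p.2), p.2))) 𝒰 := by
        refine ⟨?_, ?_, ?_, ?_⟩
        · refine AnalyticAt.prod (analyticAt_pi_iff.2 fun i => ?_) analyticAt_snd
          by_cases hi : i = j
          · subst hi; simp only [Function.update_self]; fun_prop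
          · simp only [Function.update_of_ne hi]; fun_prop
        · ext i
          · by_cases hi : i = j
            · subst hi; simp
            · simp [Function.update_of_ne hi]
          · rfl
        · have h1 : Tendsto (fun p : (ι → ℝ) × ℝ => Function.update p.1 j (p.1 j / p.2))
              (𝒰 : Filter ((ι → ℝ) × ℝ)) (𝓝 (0 : ι → ℝ)) := by
            refine tendsto_pi_nhds.2 fun i => ?_
            by_cases hi : i = j
            · subst hi; simp only [Function.update_self]
              rw [Metric.tendsto_nhds]
              intro ε hε
              filter_upwards [hR' (1/ε), hz] with p hp hp2
              simp only [Pi.zero_apply, dist_zero_right, Real.norm_eq_abs, abs_div]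
              rw [div_lt_iff₀ (abs_pos.2 hp2)]
              rw [div_mul_eq_mul_div, one_mul, div_lt_iff₀ hε] at hp
              linarith
            · simp only [Function.update_of_ne hi]
              have hc : ContinuousAt (fun p : (ι → ℝ) × ℝ => p.1 i) 0 := by fun_prop
              exact hc.tendsto.mono_left h𝒰
          have h2 : Tendsto Prod.snd (𝒰 : Filter ((ι → ℝ) × ℝ)) (𝓝 (0 : ℝ)) :=
            (continuous_snd.tendsto (0 : (ι → ℝ) × ℝ)).mono_left h𝒰
          exact h1.prodMk_nhds h2
        · rw [Ultrafilter.map_map]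
          apply Ultrafilter.coe_injective
          rw [Ultrafilter.coe_map, Filter.map_congr (m₂ := fun y => y)]
          · exact Filter.map_id
          · filter_upwards [hz] with p hp
            simp only [Function.comp, Function.update_self, Function.update_idem]
            rw [mul_div_cancel₀ _ hp, Function.update_eq_self]
      refine ⟨_, _, hA, ?_, fun p => p.2 ^ (γ j - 1) * ∏ i, p.1 i ^ γ i, by fun_prop, ?_, ?_⟩
      · rintro (_ | i)
        · exact LG.Mono.z
        · simp only [LG.lo_some]
          by_cases hi : i = j
          · subst hi; simp only [Function.update_self]
            exact LG.Mono.z.mul (LG.Mono.w i)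
          · simp only [Function.update_of_ne hi]
            exact LG.Mono.w i
      · simp only [hmon]
        simp
      · refine Eventually.of_forall fun p => ?_
        simp only
        rw [← Finset.mul_prod_erase _ _ (Finset.mem_univ j),
          ← Finset.mul_prod_erase Finset.univ (fun i => p.1 i ^ γ i) (Finset.mem_univ j)]
        have : ∏ i ∈ Finset.univ.erase j, Function.update p.1 j (p.2 * p.1 j) i ^ γ i =
            ∏ i ∈ Finset.univ.erase j, p.1 i ^ γ i := by
          refine Finset.prod_congr rfl fun i hi => ?_
          rw [Function.update_of_ne (Finset.ne_of_mem_erase hi)]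
        rw [this, Function.update_self, mul_pow]
        obtain ⟨k, hk⟩ := Nat.exists_eq_succ_of_ne_zero hj
        rw [hk]
        simp only [Nat.succ_eq_add_one, Nat.add_sub_cancel]
        ring

end

theorem LG.poly_order (m : ℕ) (C : Fin m → ℝ) (u0 a : ℝ) (hu0 : u0 ≠ 0) (k : Fin m)
    (hk : C k ≠ 0) : ∃ r < m + 1, ∃ v : ℝ → ℝ, ContinuousAt v 0 ∧ v 0 ≠ 0 ∧
      ∀ z : ℝ, ∑ i : Fin m, C i * (z + a) ^ i.val + (z + a) ^ (m+1) * u0 = z ^ r * v z := by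
  classical
  open Polynomial in
  set Q : ℝ[X] := ∑ i : Fin m, Polynomial.C (C i) * X ^ i.val + X ^ (m+1) * Polynomial.C u0 with hQ
  have hev : ∀ x : ℝ, Q.eval x = ∑ i : Fin m, C i * x ^ i.val + x ^ (m+1) * u0 := by
    intro x
    simp [hQ, Polynomial.eval_finsetSum]
    ring
  have hco : ∀ j, Q.coeff j = (∑ i : Fin m, if j = i.val then C i else 0) +
      if j = m + 1 then u0 else 0 := by
    intro j
    simp [hQ, Polynomial.coeff_X_pow]
  have hc1 : Q.coeff (m+1) = u0 := by
    rw [hco, Finset.sum_eq_zero]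
    · simp
    · intro i _; rw [if_neg]; omega
  have hc2 : Q.coeff m = 0 := by
    rw [hco, Finset.sum_eq_zero]
    · simp
    · intro i _; rw [if_neg]; omega
  have hc3 : Q.coeff k.val = C k := by
    rw [hco, Finset.sum_eq_single k]
    · have : k.val ≠ m + 1 := by omega
      simp [this]
    · intro i _ hi
      rw [if_neg]
      intro h; exact hi (Fin.ext h.symm)
    · simp
  have hQ0 : Q ≠ 0 := by
    intro h
    rw [h] at hc1
    exact hu0 (by simpa using hc1.symm)
  have hdeg : Q.natDegree ≤ m + 1 := by
    rw [Polynomial.natDegree_le_iff_coeff_eq_zero]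
    intro j hj
    rw [hco, Finset.sum_eq_zero, if_neg (by omega), add_zero]
    intro i _; rw [if_neg]; omega
  obtain ⟨Q', hQ', hnd⟩ := Polynomial.exists_eq_pow_rootMultiplicity_mul_and_not_dvd Q hQ0 a
  set r := Q.rootMultiplicity a with hr
  have hQ'0 : Q' ≠ 0 := by
    rintro rfl
    exact hnd (dvd_zero _)
  have hQ'a : Q'.eval a ≠ 0 := fun h => hnd (Polynomial.dvd_iff_isRoot.2 h)
  have hXa : (Polynomial.X - Polynomial.C a) ^ r ≠ 0 :=
    pow_ne_zero _ (Polynomial.X_sub_C_ne_zero a)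
  have hnat : Q.natDegree = r + Q'.natDegree := by
    conv_lhs => rw [hQ']
    rw [Polynomial.natDegree_mul hXa hQ'0, Polynomial.natDegree_pow, Polynomial.natDegree_X_sub_C,
      mul_one]
  refine ⟨r, ?_, fun z => Q'.eval (z + a), ?_, ?_, ?_⟩
  · by_contra! hge
    have hr' : r = m + 1 := by omega
    have hQ'd : Q'.natDegree = 0 := by omega
    obtain ⟨v, hv⟩ : ∃ v, Q' = Polynomial.C v := ⟨_, Polynomial.eq_C_of_natDegree_eq_zero hQ'd⟩
    rw [hv, hr'] at hQ'
    have hv0 : v ≠ 0 := by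
      rintro rfl
      rw [hv] at hQ'0
      simp at hQ'0
    have h1 := congrArg (fun P => P.coeff m) hQ'
    rw [sub_eq_add_neg, ← Polynomial.C_neg] at h1
    simp only [hc2, Polynomial.coeff_mul_C, Polynomial.coeff_X_add_C_pow] at h1
    have h2 : (-a) ^ (m + 1 - m) * ((m+1).choose m : ℝ) = 0 :=
      (mul_eq_zero.1 h1.symm).resolve_right hv0
    have ha : a = 0 := by
      rcases mul_eq_zero.1 h2 with h | h
      · simpa using h
      · exfalso
        have := Nat.choose_pos (show m ≤ m + 1 by omega)
        rw [Nat.cast_eq_zero] at h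
        omega
    have h3 := congrArg (fun P => P.coeff k.val) hQ'
    have hk2 : k.val ≠ m + 1 := by omega
    simp [hc3, ha, Polynomial.coeff_X_pow, hk2] at h3
    exact hk h3
  · have : Continuous (fun z : ℝ => Q'.eval (z + a)) :=
      Q'.continuous.comp (by fun_prop)
    exact this.continuousAt
  · simpa using hQ'a
  · intro z
    rw [← hev]
    conv_lhs => rw [hQ']
    simp

theorem LG.sumA (m : ℕ) (W t u : ℝ) (C : Fin m → ℝ) :
    ∑ i : Fin m, W ^ (m + 1 - i.val) * C i * (W * t) ^ i.val + (W * t) ^ (m+1) * u =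
    W ^ (m+1) * (∑ i : Fin m, C i * t ^ i.val + t ^ (m+1) * u) := by
  rw [mul_add, Finset.mul_sum]
  congr 1
  · refine Finset.sum_congr rfl fun i _ => ?_
    have : W ^ (m + 1) = W ^ (m + 1 - i.val) * W ^ i.val := by
      rw [← pow_add]; congr 1; omega
    rw [this, mul_pow]; ring
  · rw [mul_pow]; ring

theorem LG.sumB (m : ℕ) (z μ u : ℝ) (C : Fin m → ℝ) :
    ∑ i : Fin m, (z * μ) ^ (m + 1 - i.val) * C i * z ^ i.val + z ^ (m+1) * u =
    z ^ (m+1) * (∑ i : Fin m, μ ^ (m + 1 - i.val) * C i + u) := by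
  rw [mul_add, Finset.mul_sum]
  congr 1
  refine Finset.sum_congr rfl fun i _ => ?_
  have : z ^ (m + 1) = z ^ (m + 1 - i.val) * z ^ i.val := by
    rw [← pow_add]; congr 1; omega
  rw [this, mul_pow]; ring

section
variable {ι : Type*} [Fintype ι]

theorem LG.Mono.ne {E : Type*} [NormedAddCommGroup E] [NormedSpace ℝ E] {l : ι → E →L[ℝ] ℝ}
    (hl : ∀ i, l i ≠ 0) {f : E → ℝ} (h : LG.Mono l f) : ¬ ∀ᶠ x in 𝓝 (0 : E), f x = 0 := by
  intro h0
  obtain ⟨α, u, hu, hu0, h1⟩ := h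
  have hl' : ∀ i, AnalyticAt ℝ (fun x => l i x) 0 := fun i => (l i).analyticAt 0
  have hp : ∀ i, AnalyticAt ℝ (fun x => l i x ^ α i) 0 := fun i => (hl' i).fun_pow _
  have := LG.domain (f := fun x => ∏ i, l i x ^ α i) (g := u)
    (Finset.analyticAt_fun_prod _ fun i _ => hp i) hu (by
    filter_upwards [h0, h1] with x a b
    rw [← b, a])
  rcases this with h | h
  · refine LG.prod_ne Finset.univ (fun i x => l i x ^ α i) hp (fun i _ hc => ?_) h
    refine LG.clm_ne _ (hl i) (hc.mono fun x hx => ?_)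
    exact eq_zero_of_pow_eq_zero hx
  · exact hu0 h.self_of_nhds

theorem LG.claim (hM : LG.MonP ι) (d : ℕ) : ∀ (b : (ι → ℝ) → ℝ) (g : (ι → ℝ) × ℝ → ℝ)
    (u1 : ℝ → ℝ) (𝒰 : Ultrafilter ((ι → ℝ) × ℝ)), (𝒰 : Filter ((ι → ℝ) × ℝ)) ≤ 𝓝 0 →
    AnalyticAt ℝ b 0 → (¬ ∀ᶠ x in 𝓝 (0 : ι → ℝ), b x = 0) → AnalyticAt ℝ g 0 →
    ContinuousAt u1 0 → u1 0 ≠ 0 → (∀ᶠ z in 𝓝 (0 : ℝ), g (0, z) = z ^ d * u1 z) →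
    LG.Uz (LG.lo ι) (fun p => b p.1 * g p) 𝒰 := by
  induction d using Nat.strong_induction_on with
  | _ d IH =>
  intro b g u1 𝒰 h𝒰 hb hb0 hg hu1 hu10 hgd
  have fst_le : ∀ 𝒲 : Ultrafilter ((ι → ℝ) × ℝ), (𝒲 : Filter ((ι → ℝ) × ℝ)) ≤ 𝓝 0 →
      ((𝒲.map Prod.fst : Ultrafilter (ι → ℝ)) : Filter (ι → ℝ)) ≤ 𝓝 0 := by
    intro 𝒲 h
    exact (continuous_fst.tendsto (0 : (ι → ℝ) × ℝ)).mono_left h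
  rcases d with _ | m
  · obtain ⟨φ, 𝒱, hA, hm⟩ := hM b hb hb0 (𝒰.map Prod.fst) (fst_le 𝒰 h𝒰)
    obtain ⟨𝒲, hB⟩ := LG.lift_adm h𝒰 hA
    refine ⟨_, 𝒲, hB, hm.lift.mul (LG.Mono.unit (LG.an_comp hg hB.1 hB.2.1) ?_)⟩
    have h1 := hgd.self_of_nhds
    have h2 := hB.2.1
    simp only at h2
    rw [h2]
    change g (0, 0) ≠ 0
    rw [h1]; simpa using hu10
  obtain ⟨h, hh, hh0, c, hc, hc0, u, hu, hu0, hT⟩ := LG.tsch g hg m u1 hu1 hu10 hgd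
  have hh1 : AnalyticAt ℝ (fun p : (ι → ℝ) × ℝ => h p.1) 0 :=
    LG.an_comp (φ := Prod.fst) hh analyticAt_fst rfl
  have hS : LG.Adm (fun p : (ι → ℝ) × ℝ => (p.1, p.2 + h p.1))
      (𝒰.map (fun p : (ι → ℝ) × ℝ => (p.1, p.2 - h p.1))) 𝒰 := by
    refine ⟨by fun_prop, ?_, ?_, ?_⟩
    · simp [hh0]
    · have h2 : AnalyticAt ℝ (fun p : (ι → ℝ) × ℝ => (p.1, p.2 - h p.1)) 0 := by fun_prop
      exact (LG.tend h2 (by simp [hh0])).mono_left h𝒰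
    · rw [Ultrafilter.map_map]
      apply Ultrafilter.coe_injective
      rw [Ultrafilter.coe_map, Filter.map_congr (m₂ := fun y => y)]
      · exact Filter.map_id
      · refine Eventually.of_forall fun p => ?_
        simp
  refine LG.Uz.comp ?_ hS
  set 𝒱 := 𝒰.map (fun p : (ι → ℝ) × ℝ => (p.1, p.2 - h p.1))
  have h𝒱 := hS.2.2.1
  obtain ⟨φ, 𝒱', hA, hbm, hcases⟩ := LG.prep hM m b (fun i => c i.val) hb hb0 (fun i => hc i.val)
    (𝒱.map Prod.fst) (fst_le 𝒱 h𝒱)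
  obtain ⟨𝒲, hB⟩ := LG.lift_adm h𝒱 hA
  refine LG.Uz.comp ?_ hB
  set Φ : (ι → ℝ) × ℝ → (ι → ℝ) × ℝ := fun p => (φ p.1, p.2) with hΦ
  have hu' : AnalyticAt ℝ (fun p => u (Φ p)) 0 := LG.an_comp hu hB.1 hB.2.1
  have hu0' : u (Φ 0) ≠ 0 := by rw [hB.2.1]; exact hu0
  have hfst : Tendsto Prod.fst (𝓝 (0 : (ι → ℝ) × ℝ)) (𝓝 (0 : ι → ℝ)) :=
    continuous_fst.tendsto (0 : (ι → ℝ) × ℝ)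
  have hform : ∀ᶠ p in 𝓝 (0 : (ι → ℝ) × ℝ), b (φ p.1) * g (φ p.1, p.2 + h (φ p.1)) =
      b (φ p.1) * (∑ i : Fin m, c i.val (φ p.1) * p.2 ^ i.val + p.2 ^ (m+1) * u (Φ p)) := by
    filter_upwards [(LG.tend hB.1 hB.2.1).eventually hT] with p hp
    simp only [hΦ] at hp ⊢
    rw [hp, Finset.sum_range]
  refine LG.Uz.congr ?_ hform
  rcases hcases with hz | ⟨γ, c', hc'a, hc', k, hk⟩
  · refine LG.Uz.of_mono ?_ hB.2.2.1
    refine LG.Mono.congr (hbm.lift.mul ((LG.Mono.z.pow (m+1)).mul (LG.Mono.unit hu' hu0'))) ?_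
    filter_upwards [hfst.eventually (eventually_all.2 hz)] with p hp
    simp [hp]
  have hWa : AnalyticAt ℝ (fun x : ι → ℝ => ∏ j, x j ^ γ j) 0 := by fun_prop
  have hW0 : ∏ j, (0 : ι → ℝ) j ^ γ j = 0 := by
    have h1 := (hc' k).self_of_nhds
    rw [hA.2.1, hc0 k.val k.isLt] at h1
    exact eq_zero_of_pow_eq_zero ((mul_eq_zero.1 h1.symm).resolve_right hk)
  have hform2 : ∀ᶠ p in 𝓝 (0 : (ι → ℝ) × ℝ),
      b (φ p.1) * (∑ i : Fin m, c i.val (φ p.1) * p.2 ^ i.val + p.2 ^ (m+1) * u (Φ p)) =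
      b (φ p.1) * (∑ i : Fin m, (∏ j, p.1 j ^ γ j) ^ (m + 1 - i.val) * c' i p.1 * p.2 ^ i.val +
        p.2 ^ (m+1) * u (Φ p)) := by
    filter_upwards [hfst.eventually (eventually_all.2 hc')] with p hp
    congr 2
    exact Finset.sum_congr rfl fun i _ => by rw [hp]
  refine LG.Uz.congr ?_ hform2
  have hc'f : ∀ i, AnalyticAt ℝ (fun p : (ι → ℝ) × ℝ => c' i p.1) 0 := fun i =>
    LG.an_comp (φ := Prod.fst) (hc'a i) analyticAt_fst rfl
  by_cases hR : ∃ R : ℝ, ∀ᶠ p in (𝒲 : Filter ((ι → ℝ) × ℝ)), |p.2| ≤ R * |∏ j, p.1 j ^ γ j|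
  · obtain ⟨R, hR⟩ := hR
    obtain ⟨a, 𝒳, hX⟩ := LG.blowup hWa hW0 hB.2.2.1 R hR
    refine LG.Uz.comp ?_ hX
    have hux : AnalyticAt ℝ (fun p : (ι → ℝ) × ℝ =>
        u (Φ (p.1, (∏ j, p.1 j ^ γ j) * (p.2 + a)))) 0 := LG.an_comp (f := fun p => u (Φ p)) hu' hX.1 hX.2.1
    set g' : (ι → ℝ) × ℝ → ℝ := fun p => ∑ i : Fin m, c' i p.1 * (p.2 + a) ^ i.val +
      (p.2 + a) ^ (m+1) * u (Φ (p.1, (∏ j, p.1 j ^ γ j) * (p.2 + a))) with hg'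
    obtain ⟨r, hr, v, hv, hv0, hv1⟩ := LG.poly_order m (fun i => c' i 0) (u (Φ 0)) a hu0' k hk
    have hWm : LG.Mono (LG.pr ι) (fun x : ι → ℝ => (∏ j, x j ^ γ j) ^ (m+1)) :=
      LG.Mono.pow (LG.Mono.prod _ _ fun j _ => (LG.Mono.coord (l := LG.pr ι) j).pow _) _
    have hbW := hbm.mul hWm
    have := IH r hr (fun x => b (φ x) * (∏ j, x j ^ γ j) ^ (m+1)) g' v 𝒳 hX.2.2.1
      hbW.analyticAt (hbW.ne LG.pr_ne) (by
        refine AnalyticAt.fun_add ?_ (AnalyticAt.fun_mul (by fun_prop) hux)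
        fun_prop) hv hv0 (by
        refine Eventually.of_forall fun z => ?_
        rw [← hv1]
        simp only [hg', hW0, zero_mul]
        rfl)
    refine this.congr (Eventually.of_forall fun p => ?_)
    simp only [hg']
    rw [mul_assoc (b _), ← LG.sumA m _ _ _ (fun i => c' i p.1)]
  · push Not at hR
    obtain ⟨ψ, 𝒳, hX, hXm, μ, hμ, hμ0, hid⟩ := LG.lemT _ γ rfl 𝒲 hB.2.2.1 (by
      intro ε hε
      filter_upwards [hR (1/ε)] with p hp
      rw [div_mul_eq_mul_div, one_mul, div_lt_iff₀ hε] at hp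
      linarith)
    refine LG.Uz.comp ?_ hX
    refine LG.Uz.of_mono ?_ hX.2.2.1
    have hb2 : LG.Mono (LG.lo ι) (fun p => b (φ (ψ p).1)) :=
      (hbm.lift).comp hX.1 hX.2.1 hXm
    have hun : AnalyticAt ℝ (fun p => ∑ i : Fin m, μ p ^ (m+1-i.val) * c' i (ψ p).1 +
        u (Φ (ψ p))) 0 := by
      have h1 : ∀ i, AnalyticAt ℝ (fun p => c' i (ψ p).1) 0 := fun i =>
        LG.an_comp (f := fun p : (ι → ℝ) × ℝ => c' i p.1) (hc'f i) hX.1 hX.2.1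
      have h2 : AnalyticAt ℝ (fun p => u (Φ (ψ p))) 0 := LG.an_comp (f := fun p => u (Φ p)) hu' hX.1 hX.2.1
      refine AnalyticAt.fun_add ?_ h2
      exact LG.an_sum _ fun i => (hμ.fun_pow _).fun_mul (h1 i)
    have hz2 : LG.Mono (LG.lo ι) (fun p => (ψ p).2) := hXm none
    refine LG.Mono.congr (hb2.mul ((hz2.pow (m+1)).mul (LG.Mono.unit hun ?_))) ?_
    · rw [Finset.sum_eq_zero, zero_add, hX.2.1]
      · exact hu0'
      · intro i _
        rw [hμ0, zero_pow (by omega), zero_mul]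
    · filter_upwards [hid] with p hp
      rw [hp, LG.sumB m _ _ _ (fun i => c' i (ψ p).1)]

end

theorem LG.initial {ι : Type*} [Fintype ι] (hM : LG.MonP ι) (f : (ι → ℝ) × ℝ → ℝ)
    (hf : AnalyticAt ℝ f 0) (hf0 : ¬ ∀ᶠ x in 𝓝 (0 : (ι → ℝ) × ℝ), f x = 0)
    (𝒰 : Ultrafilter ((ι → ℝ) × ℝ)) (h𝒰 : (𝒰 : Filter ((ι → ℝ) × ℝ)) ≤ 𝓝 0) :
    LG.Uz (LG.lo ι) f 𝒰 := by
  obtain ⟨r, hr, hfr⟩ := hf.exists_ball_analyticOnNhd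
  obtain ⟨v, hvb, hv⟩ : ∃ v ∈ Metric.ball (0 : (ι → ℝ) × ℝ) r, v.2 * f v ≠ 0 := by
    by_contra! hcon
    have := LG.domain (f := fun p : (ι → ℝ) × ℝ => p.2) (by fun_prop) hf (by
      filter_upwards [Metric.ball_mem_nhds 0 hr] with p hp using hcon p hp)
    rcases this with h | h
    · refine LG.clm_ne (ContinuousLinearMap.snd ℝ (ι → ℝ) ℝ) ?_ h
      intro h0
      have := congrArg (fun L => L ((0, 1) : (ι → ℝ) × ℝ)) h0
      simp at this
    · exact hf0 h
  have hv2 : v.2 ≠ 0 := left_ne_zero_of_mul hv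
  have hfv : f v ≠ 0 := right_ne_zero_of_mul hv
  have hh : AnalyticOnNhd ℝ (fun t : ℝ => f (t • v)) {t : ℝ | t • v ∈ Metric.ball 0 r} := by
    intro t ht
    exact AnalyticAt.fun_comp (g := f) (f := fun t : ℝ => t • v) (hfr _ ht) (by fun_prop)
  have h0m : (0:ℝ) ∈ {t : ℝ | t • v ∈ Metric.ball 0 r} := by simpa using hr
  have h1m : (1:ℝ) ∈ {t : ℝ | t • v ∈ Metric.ball 0 r} := by
    change (1:ℝ) • v ∈ Metric.ball 0 r
    rw [one_smul]; exact hvb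
  have hconv : Convex ℝ {t : ℝ | t • v ∈ Metric.ball 0 r} :=
    (convex_ball (0 : (ι → ℝ) × ℝ) r).is_linear_preimage (f := fun t : ℝ => t • v)
      ⟨fun x y => add_smul x y v, fun c x => mul_smul c x v⟩
  have hne : ¬ ∀ᶠ t in 𝓝 (0:ℝ), f (t • v) = 0 := by
    intro h
    have := hh.eqOn_zero_of_preconnected_of_eventuallyEq_zero hconv.isPreconnected h0m h h1m
    simp only [one_smul, Pi.zero_apply] at this
    exact hfv this
  have hha : AnalyticAt ℝ (fun t : ℝ => f (t • v)) 0 := hh 0 h0m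
  have hord : analyticOrderAt (fun t : ℝ => f (t • v)) 0 ≠ ⊤ := by
    rw [ne_eq, analyticOrderAt_eq_top]; exact hne
  obtain ⟨u1, hu1, hu10, hu⟩ := hha.analyticOrderAt_ne_top.1 hord
  set d := analyticOrderNatAt (fun t : ℝ => f (t • v)) 0
  have hL : LG.Adm (fun p : (ι → ℝ) × ℝ => (p.1 + p.2 • v.1, p.2 * v.2))
      (𝒰.map fun p : (ι → ℝ) × ℝ => (p.1 - (p.2 / v.2) • v.1, p.2 / v.2)) 𝒰 := by
    refine ⟨by fun_prop, by simp, ?_, ?_⟩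
    · have hc : ContinuousAt (fun p : (ι → ℝ) × ℝ => (p.1 - (p.2 / v.2) • v.1, p.2 / v.2)) 0 := by
        fun_prop
      have := hc.tendsto.mono_left h𝒰
      simp only [Prod.fst_zero, Prod.snd_zero, zero_div, zero_smul, sub_zero] at this
      exact this
    · rw [Ultrafilter.map_map]
      apply Ultrafilter.coe_injective
      rw [Ultrafilter.coe_map, Filter.map_congr (m₂ := fun y => y)]
      · exact Filter.map_id
      · refine Eventually.of_forall fun p => ?_
        simp [hv2]
  refine LG.Uz.comp ?_ hL
  refine LG.Uz.congr (LG.claim hM d (fun _ => 1) _ u1 _ hL.2.2.1 analyticAt_const ?_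
    (LG.an_comp hf hL.1 hL.2.1) hu1.continuousAt hu10 ?_) (Eventually.of_forall fun p =>
      (one_mul _).symm)
  · simpa using (inferInstance : (𝓝 (0 : ι → ℝ)).NeBot).ne
  · filter_upwards [hu] with z hz
    simp only [sub_zero, smul_eq_mul] at hz
    rw [← hz]
    congr 1
    ext <;> simp

theorem LG.monP (n : ℕ) : LG.MonP (Fin n) := by
  induction n with
  | zero =>
    intro f hf hf0 𝒰 h𝒰
    refine LG.Uz.of_mono (LG.Mono.unit hf fun h => hf0 ?_) h𝒰
    refine Eventually.of_forall fun x => ?_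
    rw [Subsingleton.elim x 0]; exact h
  | succ n ih =>
    intro f hf hf0 𝒰 h𝒰
    set e : (Fin n → ℝ) × ℝ → (Fin (n+1) → ℝ) := fun p => Fin.cons p.2 p.1 with he
    set e' : (Fin (n+1) → ℝ) → (Fin n → ℝ) × ℝ := fun w => (fun i => w i.succ, w 0) with he'
    have hea : AnalyticAt ℝ e 0 := by
      refine analyticAt_pi_iff.2 fun i => ?_
      refine Fin.cases ?_ (fun i => ?_) i
      · simp only [he, Fin.cons_zero]; fun_prop
      · simp only [he, Fin.cons_succ]; fun_prop
    have hea' : AnalyticAt ℝ e' 0 := by fun_prop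
    have he0 : e 0 = 0 := by
      funext i
      refine Fin.cases ?_ (fun i => ?_) i <;> simp [he]
    have he0' : e' 0 = 0 := rfl
    have hee' : ∀ w, e (e' w) = w := by
      intro w; simp only [he, he']
      exact Fin.cons_self_tail w
    have he'e : ∀ p, e' (e p) = p := by
      intro p; simp [he, he']
    have hA1 : LG.Adm e (𝒰.map e') 𝒰 := by
      refine ⟨hea, he0, (LG.tend hea' he0').mono_left h𝒰, ?_⟩
      rw [Ultrafilter.map_map]
      have : e ∘ e' = id := funext hee'
      rw [this]; exact Ultrafilter.map_id _
    have hne : ¬ ∀ᶠ p in 𝓝 (0 : (Fin n → ℝ) × ℝ), f (e p) = 0 := by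
      intro h
      apply hf0
      filter_upwards [(LG.tend hea' he0').eventually h] with w hw
      rwa [hee'] at hw
    obtain ⟨φ, 𝒱, hA2, hm⟩ := LG.initial ih (fun p => f (e p)) (LG.an_comp hf hea he0) hne _ hA1.2.2.1
    have hA3 : LG.Adm e' (𝒱.map e) 𝒱 := by
      refine ⟨hea', he0', (LG.tend hea he0).mono_left hA2.2.2.1, ?_⟩
      rw [Ultrafilter.map_map]
      have : e' ∘ e = id := funext he'e
      rw [this]; exact Ultrafilter.map_id _
    refine ⟨_, _, (hA1.comp hA2).comp hA3, ?_⟩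
    refine LG.Mono.comp (l := LG.pr (Fin (n+1))) hm hea' he0' ?_
    rintro (_ | i)
    · exact LG.Mono.coord (l := LG.pr (Fin (n+1))) 0
    · exact LG.Mono.coord (l := LG.pr (Fin (n+1))) i.succ

theorem LG.lower {ι : Type*} [Fintype ι] (G u : (ι → ℝ) → ℝ) (α : ι → ℕ) (hu : AnalyticAt ℝ u 0)
    (hu0 : u 0 ≠ 0) (hα : ∑ i, α i ≠ 0) (hG : ∀ᶠ x in 𝓝 (0 : ι → ℝ), G x = (∏ i, x i ^ α i) * u x) :
    ∃ c : ℝ, 0 < c ∧ ∀ᶠ w in 𝓝 (0 : ι → ℝ), G w ≠ 0 →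
      c * |G w| ^ (1 - 1 / ((∑ i, α i : ℕ) : ℝ)) ≤ ‖fderiv ℝ G w‖ := by
  classical
  set a : ℕ := ∑ i, α i with ha
  have ha1 : (1:ℝ) ≤ a := by
    exact_mod_cast Nat.one_le_iff_ne_zero.2 hα
  have hexp : 0 ≤ 1 - 1 / (a:ℝ) := by
    rw [sub_nonneg, div_le_one (by linarith)]; exact ha1
  have hU : 0 < |u 0| := abs_pos.2 hu0
  refine ⟨|u 0| / 2 * (1 / (2 * |u 0|)) ^ (1 - 1 / (a:ℝ)), by positivity, ?_⟩
  have e1 : ∀ᶠ w in 𝓝 (0 : ι → ℝ), |u 0| / 2 < |u w| - ‖w‖ * ‖fderiv ℝ u w‖ := by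
    have hc : ContinuousAt (fun w => |u w| - ‖w‖ * ‖fderiv ℝ u w‖) 0 :=
      (hu.continuousAt.abs).sub (continuousAt_id.norm.mul hu.fderiv.continuousAt.norm)
    exact continuousAt_const.eventually_lt hc (by simpa using hu0)
  have e2 : ∀ᶠ w in 𝓝 (0 : ι → ℝ), |u w| < 2 * |u 0| :=
    hu.continuousAt.abs.eventually_lt continuousAt_const (by linarith)
  filter_upwards [e1, e2, hG.eventually_nhds, hu.eventually_analyticAt] with w h1 h2 h3 h4 hGw
  have hGw' := h3.self_of_nhds
  set T := |∏ i, w i ^ α i| with hT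
  have hGT : |G w| = T * |u w| := by rw [hGw', abs_mul]
  have hTpos : 0 < T := by
    rw [hT, abs_pos]
    intro h
    rw [h, zero_mul] at hGw'
    exact hGw hGw'
  have hne : (Finset.univ.filter fun i => α i ≠ 0).Nonempty := by
    by_contra! h
    rw [Finset.filter_eq_empty_iff] at h
    apply hα
    rw [ha]
    refine Finset.sum_eq_zero fun i hi => ?_
    have := h hi
    simpa using this
  obtain ⟨i, hi, himin⟩ := Finset.exists_min_image _ (fun i => |w i|) hne
  have hαi : α i ≠ 0 := (Finset.mem_filter.1 hi).2
  have hwi : w i ≠ 0 := by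
    intro h
    rw [hT, Finset.prod_eq_zero (Finset.mem_univ i) (by rw [h, zero_pow hαi])] at hTpos
    simp at hTpos
  have hma : |w i| ^ a ≤ T := by
    rw [hT, Finset.abs_prod, ha, ← Finset.prod_pow_eq_pow_sum]
    refine Finset.prod_le_prod (fun j _ => by positivity) fun j _ => ?_
    rw [abs_pow]
    by_cases hj : α j = 0
    · simp [hj]
    · exact pow_le_pow_left₀ (abs_nonneg _) (himin j (by simp [hj])) _
  have hdG : DifferentiableAt ℝ G w := by
    have : DifferentiableAt ℝ (fun x : ι → ℝ => (∏ i, x i ^ α i) * u x) w := by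
      have hh : AnalyticAt ℝ (fun x : ι → ℝ => (∏ i, x i ^ α i) * u x) w := by fun_prop
      exact hh.differentiableAt
    exact this.congr_of_eventuallyEq h3
  set s : ι → ℝ := Pi.single i (w i) with hs
  have hcurve : HasDerivAt (fun t : ℝ => w + t • s) s 0 := by
    have := ((hasDerivAt_id (0:ℝ)).smul_const s).const_add w
    simpa using this
  have hd1 : HasDerivAt (fun t : ℝ => G (w + t • s)) (fderiv ℝ G w s) 0 := by
    have : HasFDerivAt G (fderiv ℝ G w) (w + (0:ℝ) • s) := by
      rw [zero_smul, add_zero]; exact hdG.hasFDerivAt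
    exact this.comp_hasDerivAt (0:ℝ) hcurve
  have hd2 : HasDerivAt (fun t : ℝ => u (w + t • s)) (fderiv ℝ u w s) 0 := by
    have : HasFDerivAt u (fderiv ℝ u w) (w + (0:ℝ) • s) := by
      rw [zero_smul, add_zero]; exact h4.differentiableAt.hasFDerivAt
    exact this.comp_hasDerivAt (0:ℝ) hcurve
  have hprod : ∀ t : ℝ, ∏ j, (w + t • s) j ^ α j = (1 + t) ^ α i * ∏ j, w j ^ α j := by
    intro t
    rw [← Finset.mul_prod_erase _ _ (Finset.mem_univ i),
      ← Finset.mul_prod_erase Finset.univ (fun j => w j ^ α j) (Finset.mem_univ i), ← mul_assoc]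
    congr 1
    · rw [← mul_pow]; congr 1; simp [hs]; ring
    · refine Finset.prod_congr rfl fun j hj => ?_
      simp [hs, Pi.single_eq_of_ne (Finset.ne_of_mem_erase hj)]
  have hd3 : HasDerivAt (fun t : ℝ => ((1 + t) ^ α i * ∏ j, w j ^ α j) * u (w + t • s))
      ((α i * ∏ j, w j ^ α j) * u w + (∏ j, w j ^ α j) * fderiv ℝ u w s) 0 := by
    have hp : HasDerivAt (fun t : ℝ => (1 + t) ^ α i) (α i : ℝ) 0 := by
      have := ((hasDerivAt_id (0:ℝ)).const_add 1).fun_pow (α i)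
      simpa using this
    have := (hp.mul_const (∏ j, w j ^ α j)).fun_mul hd2
    simpa using this
  have hd4 := hd3.congr_of_eventuallyEq (f₁ := fun t : ℝ => G (w + t • s)) (by
    have ht : Tendsto (fun t : ℝ => w + t • s) (𝓝 0) (𝓝 w) := by
      have := hcurve.continuousAt.tendsto
      simpa using this
    filter_upwards [ht.eventually h3] with t ht
    rw [ht, hprod])
  have hD := hd1.unique hd4
  have hsn : ‖s‖ = |w i| := by rw [hs, Pi.norm_single, Real.norm_eq_abs]
  have hlow : T * (|u 0| / 2) ≤ ‖fderiv ℝ G w‖ * |w i| := by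
    have b1 : |fderiv ℝ u w s| ≤ ‖w‖ * ‖fderiv ℝ u w‖ := by
      have := (fderiv ℝ u w).le_opNorm s
      rw [hsn, Real.norm_eq_abs] at this
      have h5 : |w i| ≤ ‖w‖ := norm_le_pi_norm w i
      calc _ ≤ _ := this
        _ ≤ ‖fderiv ℝ u w‖ * ‖w‖ := by gcongr
        _ = _ := mul_comm _ _
    have b2 : |fderiv ℝ G w s| = T * |α i * u w + fderiv ℝ u w s| := by
      rw [hD, hT, ← abs_mul]; congr 1; ring
    have b3 : |u w| ≤ |α i * u w| := by
      rw [abs_mul, Nat.abs_cast]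
      have : (1:ℝ) ≤ α i := by exact_mod_cast Nat.one_le_iff_ne_zero.2 hαi
      nlinarith [abs_nonneg (u w)]
    have b4 : |α i * u w| - |fderiv ℝ u w s| ≤ |α i * u w + fderiv ℝ u w s| := by
      have := abs_sub_abs_le_abs_sub (α i * u w) (-(fderiv ℝ u w s))
      rwa [abs_neg, sub_neg_eq_add] at this
    have b5 := (fderiv ℝ G w).le_opNorm s
    rw [hsn, Real.norm_eq_abs, b2] at b5
    refine le_trans ?_ b5
    gcongr
    linarith
  have hmT : |w i| ≤ T ^ (1 / (a:ℝ)) := by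
    have := Real.rpow_le_rpow (by positivity) hma (z := 1 / (a:ℝ)) (by positivity)
    rwa [← Real.rpow_natCast, ← Real.rpow_mul (abs_nonneg _), mul_one_div_cancel (by positivity),
      Real.rpow_one] at this
  have hfin : |u 0| / 2 * T ^ (1 - 1 / (a:ℝ)) ≤ ‖fderiv ℝ G w‖ := by
    have hp : 0 < T ^ (1 / (a:ℝ)) := Real.rpow_pos_of_pos hTpos _
    have h6 : T * (|u 0| / 2) ≤ ‖fderiv ℝ G w‖ * T ^ (1 / (a:ℝ)) := by
      refine hlow.trans ?_
      gcongr
    rw [Real.rpow_sub hTpos, Real.rpow_one, mul_div_assoc', div_le_iff₀ hp]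
    linarith
  refine le_trans ?_ hfin
  rw [mul_assoc, ← Real.mul_rpow (by positivity) (abs_nonneg _)]
  gcongr
  rw [hGT, div_mul_eq_mul_div, one_mul, div_le_iff₀ (by positivity)]
  gcongr

/-- The Łojasiewicz gradient inequality for real analytic functions on
`ℝⁿ`: near a critical point `p`, `‖∇f(q)‖ ≥ C |f q − f p|^θ` for some `C > 0` and
`θ ∈ [1/2, 1)`. -/
theorem lojasiewicz_gradient_inequality
    (n : ℕ) (hn : 1 ≤ n)
    (f : EuclideanSpace ℝ (Fin n) → ℝ)
    (hf : ∀ x, AnalyticAt ℝ f x)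
    (p : EuclideanSpace ℝ (Fin n))
    (hcrit : gradient f p = 0) :
    ∃ U ∈ nhds p, ∃ C : ℝ, 0 < C ∧ ∃ θ : ℝ, θ ∈ Set.Ico (1/2 : ℝ) 1 ∧
      ∀ q ∈ U, C * |f q - f p| ^ θ ≤ ‖gradient f q‖ := by
  set L := (EuclideanSpace.equiv (Fin n) ℝ) with hL
  set e : (Fin n → ℝ) → EuclideanSpace ℝ (Fin n) := fun x => p + L.symm x with he
  set e' : EuclideanSpace ℝ (Fin n) → (Fin n → ℝ) := fun q => L (q - p) with he'
  have hee' : ∀ q, e (e' q) = q := fun q => by simp [he, he']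
  have he0 : e 0 = p := by simp [he]
  have hLs : ∀ x, AnalyticAt ℝ (fun x => L.symm x) x := fun x =>
    (L.symm : (Fin n → ℝ) →L[ℝ] EuclideanSpace ℝ (Fin n)).analyticAt x
  have hea : ∀ x, AnalyticAt ℝ e x := fun x => analyticAt_const.add (hLs x)
  have he'c : Tendsto e' (𝓝 p) (𝓝 0) := by
    have : Continuous e' := by
      simp only [he']; fun_prop
    have h := this.tendsto p
    simpa [he'] using h
  have hFa : ∀ x, AnalyticAt ℝ (fun x => f (e x) - f p) x := fun x =>
    ((hf (e x)).comp (hea x)).sub analyticAt_const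
  by_cases hF0 : ∀ᶠ x in 𝓝 (0 : Fin n → ℝ), f (e x) - f p = 0
  · refine ⟨{q | f q - f p = 0}, ?_, 1, one_pos, 1/2, by norm_num, ?_⟩
    · filter_upwards [he'c.eventually hF0] with q hq
      rwa [hee'] at hq
    · intro q hq
      rw [Set.mem_ofPred_eq] at hq
      rw [hq, abs_zero, Real.zero_rpow (by norm_num)]
      simp
  by_contra hcon
  have hk : ∀ k : ℕ, ∃ q, dist q p < 1 / ((k:ℝ) + 1) ∧ |f q - f p| < 1 ∧
      ‖gradient f q‖ < 1 / ((k:ℝ) + 2) * |f q - f p| ^ (1 - 1 / ((k:ℝ) + 2)) := by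
    intro k
    by_contra! h
    apply hcon
    have hk0 : (0:ℝ) ≤ k := Nat.cast_nonneg k
    refine ⟨Metric.ball p (1 / ((k:ℝ) + 1)) ∩ {q | |f q - f p| < 1},
      inter_mem (Metric.ball_mem_nhds _ (by positivity)) ?_, 1 / ((k:ℝ) + 2), by positivity,
      1 - 1 / ((k:ℝ) + 2), ⟨?_, ?_⟩, ?_⟩
    · have hc : ContinuousAt (fun q => |f q - f p|) p :=
        ((hf p).continuousAt.sub continuousAt_const).abs
      exact hc.eventually_lt continuousAt_const (by simp)
    · have : 1 / ((k:ℝ) + 2) ≤ 1 / 2 := one_div_le_one_div_of_le (by norm_num) (by linarith)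
      linarith
    · have : 0 < 1 / ((k:ℝ) + 2) := by positivity
      linarith
    · rintro q ⟨h1, h2⟩
      exact h q h1 h2
  choose q hq1 hq2 hq3 using hk
  have hqp : Tendsto q atTop (𝓝 p) := by
    rw [tendsto_iff_dist_tendsto_zero]
    exact squeeze_zero (fun _ => dist_nonneg) (fun k => (hq1 k).le)
      tendsto_one_div_add_atTop_nhds_zero_nat
  set 𝒰 : Ultrafilter (Fin n → ℝ) := (hyperfilter ℕ).map (fun k => e' (q k)) with h𝒰
  have h𝒰0 : (𝒰 : Filter (Fin n → ℝ)) ≤ 𝓝 0 := by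
    have h1 : Tendsto (fun k => e' (q k)) atTop (𝓝 0) := he'c.comp hqp
    have h2 : ((hyperfilter ℕ : Ultrafilter ℕ) : Filter ℕ) ≤ atTop := by
      rw [← Nat.cofinite_eq_atTop]; exact hyperfilter_le_cofinite
    exact h1.mono_left h2
  obtain ⟨φ, 𝒱, hA, α, u, hu, hu0, hG⟩ := LG.monP n _ (hFa 0) hF0 𝒰 h𝒰0
  have hφ0 := hA.2.1
  have hφa := hA.1
  have hα : ∑ i, α i ≠ 0 := by
    intro h
    have h0 := hG.self_of_nhds
    beta_reduce at h0
    rw [hφ0, he0, sub_self] at h0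
    have hz : ∀ i, α i = 0 := fun i =>
      (Finset.sum_eq_zero_iff.1 h) i (Finset.mem_univ i)
    simp only [hz, pow_zero, Finset.prod_const_one, one_mul] at h0
    exact hu0 h0.symm
  obtain ⟨c, hc, hlow⟩ := LG.lower (fun x => f (e (φ x)) - f p) u α hu hu0 hα hG
  set a : ℕ := ∑ i, α i with ha
  have hψa : AnalyticAt ℝ (fun w => e (φ w)) 0 := (hea (φ 0)).comp hφa
  obtain ⟨M, hM0, hM⟩ : ∃ M : ℝ, 0 < M ∧ ∀ᶠ w in 𝓝 (0 : Fin n → ℝ), ‖fderiv ℝ (fun w => e (φ w)) w‖ < M :=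
    ⟨‖fderiv ℝ (fun w => e (φ w)) 0‖ + 1, by positivity,
      hψa.fderiv.continuousAt.norm.eventually_lt continuousAt_const (by linarith)⟩
  obtain ⟨K, hK⟩ := exists_nat_gt (max (a:ℝ) (M / c))
  have hK1 : (a:ℝ) < K := (le_max_left _ _).trans_lt hK
  have hK2 : M / c < K := (le_max_right _ _).trans_lt hK
  have hev : ∀ᶠ w in (𝒱 : Filter (Fin n → ℝ)), ∃ k : ℕ, K ≤ k ∧ φ w = e' (q k) := by
    refine (hA.ev (p := fun y => ∃ k : ℕ, K ≤ k ∧ y = e' (q k))).2 ?_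
    have h2 : ((hyperfilter ℕ : Ultrafilter ℕ) : Filter ℕ) ≤ atTop := by
      rw [← Nat.cofinite_eq_atTop]; exact hyperfilter_le_cofinite
    have : ∀ᶠ k in ((hyperfilter ℕ : Ultrafilter ℕ) : Filter ℕ), ∃ k' : ℕ, K ≤ k' ∧ e' (q k) = e' (q k') :=
      h2 ((eventually_ge_atTop K).mono fun k hk => ⟨k, hk, rfl⟩)
    rw [h𝒰, Ultrafilter.coe_map, eventually_map]
    exact this
  obtain ⟨w, ⟨k, hk, hwk⟩, hl, hMw, hφw⟩ := (hev.and (hA.2.2.1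
    (hlow.and (hM.and hψa.eventually_analyticAt)))).exists
  have heq : e (φ w) = q k := by rw [hwk, hee']
  simp only [heq] at hl
  have hkK : (K:ℝ) ≤ k := by exact_mod_cast hk
  have ha0 : (1:ℝ) ≤ a := by exact_mod_cast Nat.one_le_iff_ne_zero.2 hα
  have hk2 : (0:ℝ) < (k:ℝ) + 2 := by positivity
  have h3 := hq3 k
  have hexp : 0 < 1 - 1 / ((k:ℝ) + 2) := by
    rw [sub_pos, div_lt_one hk2]; linarith
  have hne : f (q k) - f p ≠ 0 := by
    intro h
    rw [h, abs_zero, Real.zero_rpow hexp.ne', mul_zero] at h3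
    exact absurd h3 (not_lt.2 (norm_nonneg _))
  have hpos : 0 < |f (q k) - f p| := abs_pos.2 hne
  have hl' := hl hne
  have hgr : ‖fderiv ℝ f (q k)‖ = ‖gradient f (q k)‖ := by
    simp [gradient]
  have hchain : ‖fderiv ℝ (fun x => f (e (φ x)) - f p) w‖ ≤ ‖gradient f (q k)‖ * M := by
    have h1 : HasFDerivAt (fun x => f (e (φ x)) - f p)
        ((fderiv ℝ f (e (φ w))).comp (fderiv ℝ (fun w => e (φ w)) w)) w :=
      ((hf (e (φ w))).differentiableAt.hasFDerivAt.comp w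
        hφw.differentiableAt.hasFDerivAt).sub_const _
    rw [h1.fderiv, heq]
    refine (ContinuousLinearMap.opNorm_comp_le _ _).trans ?_
    rw [hgr]
    exact mul_le_mul_of_nonneg_left hMw.le (norm_nonneg _)
  have hmono : |f (q k) - f p| ^ (1 - 1 / ((k:ℝ) + 2)) ≤ |f (q k) - f p| ^ (1 - 1 / (a:ℝ)) := by
    apply Real.rpow_le_rpow_of_exponent_ge hpos (hq2 k).le
    have : 1 / ((k:ℝ) + 2) ≤ 1 / (a:ℝ) := one_div_le_one_div_of_le (by linarith) (by linarith)
    linarith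
  have hB : 0 < |f (q k) - f p| ^ (1 - 1 / (a:ℝ)) := Real.rpow_pos_of_pos hpos _
  have hMc : M < c * ((k:ℝ) + 2) := by
    rw [div_lt_iff₀ hc] at hK2
    nlinarith
  have hfin : c * |f (q k) - f p| ^ (1 - 1 / (a:ℝ)) <
      1 / ((k:ℝ) + 2) * |f (q k) - f p| ^ (1 - 1 / (a:ℝ)) * M := by
    refine (hl'.trans hchain).trans_lt (mul_lt_mul_of_pos_right (h3.trans_le ?_) hM0)
    exact mul_le_mul_of_nonneg_left hmono (by positivity)
  have : c * ((k:ℝ) + 2) < M := by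
    have h5 : c * |f (q k) - f p| ^ (1 - 1 / (a:ℝ)) <
      (M / ((k:ℝ) + 2)) * |f (q k) - f p| ^ (1 - 1 / (a:ℝ)) := by
      calc _ < _ := hfin
        _ = _ := by ring
    have h6 := lt_of_mul_lt_mul_right h5 hB.le
    rwa [lt_div_iff₀ hk2] at h6
  linarith
end
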